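/- Fix 1 ≤ i ≤ n, let e = e_{i+1} + ⋯ + e_n and A' = A/AeA, and let Δ(i) = A'ē_i (the image of e_i in A'), which is an indecomposable projective A'-module and coincides with the standard A-module Δ(i). Let E = End_{A'}(Δ(i))^{op}, a local finite-dimensional K-algebra, and let S_E = Hom_{A'}(Δ(i), Δ̄(i)), which is the simple E-module. Then there is an isomorphism of ℤ-graded K-algebras Ext^*_{A'}(Δ̄(i),Δ̄(i)) ≅ Ext^*_E(S_E,S_E), induced by applying the exact functor Hom_{A'}(Δ(i),−) to a projective resolution of Δ̄(i) all of whose terms are finite direct sums of copies of Δ(i). -/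

import Mathlib

/-!
STATEMENT 10 (Proposition "A'E iso" of the paper).

`A` is a finite-dimensional basic `K`-algebra (`K` algebraically closed) with a complete
set of pairwise orthogonal primitive idempotents `e 0, …, e (n-1)` (with pairwise
non-isomorphic projectives `P(i) = Ae_i`, encoded as `leftIdeal A (e i)`), assumed
`Δ̄`-filtered.  For a fixed `i`, the quotient `A' = A/AεA` with `ε = e_{i+1} + ⋯ + e_n` is
encoded abstractly as a `K`-algebra `A'` together with a surjective ring homomorphism
`ρ : A → A'`, compatible with the `K`-algebra structures, whose kernel is the two-sided
ideal `AεA`; `ē j := ρ (e j)`.  `Δ(i) = A'ē_i` is `leftIdeal A' (ρ (e i))`,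
`E = End_{A'}(Δ(i))ᵒᵖ`, and `S_E = Hom_{A'}(Δ(i), Δ̄(i))` (an `E`-module by precomposition,
`homEndOpModule`), where `Δ̄(i) = PStd A' (ρ ∘ e) i` is the properly standard `A'`-module.

`Ext^*` algebras are encoded via chosen projective resolutions: `Ext^k` is the space of
degree-`k` chain maps of the resolution modulo null-homotopic ones (the statement
quantifies over arbitrary chosen projective resolutions, over `A'` of `Δ̄(i)` and over `E`
of `S_E`); an isomorphism of ℤ-graded `K`-algebras is a family of `K`-linear bijections in
each degree preserving the unit and compatible with the Yoneda products
(`IsGradedExtAlgIso`).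
-/

noncomputable section

def mulRightLin (A : Type*) [Ring A] (a : A) : A →ₗ[A] A where
  toFun x := x * a
  map_add' x y := add_mul x y a
  map_smul' r x := by simp [smul_eq_mul, mul_assoc]

def leftIdeal (A : Type*) [Ring A] (a : A) : Submodule A A := LinearMap.range (mulRightLin A a)

def jacRad (A : Type*) [Ring A] : Ideal A := sInf {I : Ideal A | I.IsMaximal}

def radM (A : Type*) [Ring A] (M : Type*) [AddCommGroup M] [Module A M] : Submodule A M :=
  Submodule.span A {x | ∃ r ∈ jacRad A, ∃ m : M, x = r • m}

def IsRadHom (A : Type*) [Ring A] {M N : Type*} [AddCommGroup M] [Module A M]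
    [AddCommGroup N] [Module A N] (f : M →ₗ[A] N) : Prop :=
  LinearMap.range f ≤ radM A N

def IsPrimitiveIdem (A : Type*) [Ring A] (x : A) : Prop :=
  IsIdempotentElem x ∧ x ≠ 0 ∧ ∀ y z : A, IsIdempotentElem y → IsIdempotentElem z →
    y * z = 0 → z * y = 0 → x = y + z → y = 0 ∨ z = 0

def properU (A : Type*) [Ring A] {n : ℕ} (e : Fin n → A) (i : Fin n) :
    Submodule A ↥(leftIdeal A (e i)) :=
  ⨆ (j : Fin n) (_ : i ≤ j) (φ : ↥(leftIdeal A (e j)) →ₗ[A] ↥(leftIdeal A (e i)))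
    (_ : IsRadHom A φ), LinearMap.range φ

abbrev PStd (A : Type*) [Ring A] {n : ℕ} (e : Fin n → A) (i : Fin n) :=
  ↥(leftIdeal A (e i)) ⧸ properU A e i

def HasPStdFilt (A : Type u) [Ring A] {n : ℕ} (e : Fin n → A) (cond : Fin n → Prop)
    (M : Type u) [AddCommGroup M] [Module A M] : Prop :=
  ∃ (m : ℕ) (X : ℕ → Submodule A M), X 0 = ⊤ ∧ X m = ⊥ ∧ (∀ t, X (t + 1) ≤ X t) ∧
    ∀ t < m, ∃ j, cond j ∧ Nonempty
      ((↥(X t) ⧸ Submodule.comap (X t).subtype (X (t + 1))) ≃ₗ[A] PStd A e j)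

/-- `Hom_R(M,N)` is a left module over `E = End_R(M)ᵒᵖ` by precomposition -/
instance homEndOpModule (R : Type*) [Ring R] (M N : Type*) [AddCommGroup M] [Module R M]
    [AddCommGroup N] [Module R N] : Module (Module.End R M)ᵐᵒᵖ (M →ₗ[R] N) where
  smul e f := f ∘ₗ e.unop
  one_smul f := by ext x; rfl
  mul_smul a b f := by ext x; rfl
  smul_zero e := by ext x; rfl
  smul_add e f g := by ext x; rfl
  add_smul a b f := by
    show f ∘ₗ (a.unop + b.unop) = f ∘ₗ a.unop + f ∘ₗ b.unop
    ext x; simp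
  zero_smul f := by
    show f ∘ₗ (0 : Module.End R M) = 0
    ext x; simp

/-- `ε = e_{i+1} + ⋯ + e_n` -/
def sumLater (A : Type*) [Ring A] {n : ℕ} (e : Fin n → A) (i : Fin n) : A :=
  ∑ j ∈ Finset.univ.filter (fun j => i < j), e j

section ExtMachinery

variable {A : Type*} [Ring A]
variable (P : ℕ → Type*) [∀ l, AddCommGroup (P l)] [∀ l, Module A (P l)]

/-- transport along an equality of indices -/
def pcast {a b : ℕ} (h : a = b) : P a →ₗ[A] P b := by subst h; exact LinearMap.id

/-- the space `𝒜^k = Hom_A(P•,P•[k])` of degree-`k` families of maps, an element being the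
family of its components `g^{(k+m)} : P_{k+m} → P_m` -/
abbrev ExtDeg (A : Type*) [Ring A] (P : ℕ → Type*) [∀ l, AddCommGroup (P l)]
    [∀ l, Module A (P l)] (k : ℕ) := ∀ m : ℕ, P (k + m) →ₗ[A] P m

variable (dP : ∀ l, P (l + 1) →ₗ[A] P l)

/-- the chain-map condition `g^{(l)} ∘ ∂_{l+1} = (-1)^k ∂_{l-k+1} ∘ g^{(l+1)}` -/
def IsChainMap (k : ℕ) (g : ExtDeg A P k) : Prop :=
  ∀ m, (g m) ∘ₗ (dP (k + m)) = ((-1 : ℤ) ^ k) • ((dP m) ∘ₗ (g (m + 1)))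

/-- null-homotopy: for `k ≥ 1`, `g^{(l)} = ∂_{l-k+1} ∘ u^{(l)} - (-1)^(k-1) u^{(l-1)} ∘ ∂_l`
with `u^{(l)} : P_l → P_{l-k+1}` (encoded as `h m := u^{(m+k-1)}`); for `k = 0` the same with
`u^{(l)} : P_l → P_{l+1}` (encoded as `h m := u^{(m)}`) and `u^{(-1)} = 0`. -/
def IsNullMap : (k : ℕ) → ExtDeg A P k → Prop
  | 0, g => ∃ h : ∀ m, P m →ₗ[A] P (m + 1),
      (g 0 = dP 0 ∘ₗ h 0 ∘ₗ pcast P (by omega : (0 : ℕ) + 0 = 0)) ∧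
      ∀ m, g (m + 1) = (dP (m + 1) ∘ₗ h (m + 1) + h m ∘ₗ dP m) ∘ₗ
        pcast P (by omega : 0 + (m + 1) = m + 1)
  | (k' + 1), g => ∃ h : ∀ m, P (k' + m) →ₗ[A] P m,
      ∀ m, g m = (dP m ∘ₗ h (m + 1)) ∘ₗ pcast P (by omega : (k' + 1) + m = k' + (m + 1)) -
        ((-1 : ℤ) ^ k') • ((h m ∘ₗ dP (k' + m)) ∘ₗ
          pcast P (by omega : (k' + 1) + m = (k' + m) + 1))

variable (K : Type*) [Field K] [Algebra K A]
  [∀ l, Module K (P l)] [∀ l, IsScalarTower K A (P l)] [∀ l, SMulCommClass A K (P l)]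

/-- the `K`-subspace of chain maps (the set of chain maps is a subspace, so taking the span
does not change it) -/
def chainSub (k : ℕ) : Submodule K (ExtDeg A P k) :=
  Submodule.span K {g | IsChainMap P dP k g}

/-- the `K`-subspace of null-homotopic families -/
def nullSub (k : ℕ) : Submodule K (ExtDeg A P k) :=
  Submodule.span K {g | IsNullMap P dP k g}

/-- `Ext^k`: chain maps modulo null-homotopic chain maps, computed from the chosen
projective resolution `P•` -/
abbrev extQ (k : ℕ) := ↥(chainSub P dP K k) ⧸
  (Submodule.comap (chainSub P dP K k).subtype (nullSub P dP K k))

/-- the class in `Ext^k` of a chain map -/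
def extMk (k : ℕ) (g : ExtDeg A P k) (hg : IsChainMap P dP k g) : extQ P dP K k :=
  Submodule.Quotient.mk ⟨g, Submodule.subset_span hg⟩

/-- composition of degree-`j` and degree-`k` elements (the Yoneda product on `Ext`) -/
def extComp {j k : ℕ} (f : ExtDeg A P j) (g : ExtDeg A P k) : ExtDeg A P (j + k) :=
  fun m => (f m ∘ₗ g (j + m)) ∘ₗ pcast P (by omega : (j + k) + m = k + (j + m))

/-- the identity chain map, of degree `0` -/
def extId : ExtDeg A P 0 := fun m => pcast P (by omega : 0 + m = m)

end ExtMachinery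

/-- A family of `K`-linear bijections `Ext^k_A(M,M) ≅ Ext^k_B(N,N)` (computed from chosen
projective resolutions `P•` of `M` over `A` and `P'•` of `N` over `B`) is an isomorphism of
ℤ-graded `K`-algebras: it sends the identity to the identity and is compatible with the
Yoneda products (composition of chain maps). -/
def IsGradedExtAlgIso
    {A : Type*} [Ring A] (P : ℕ → Type*) [∀ l, AddCommGroup (P l)] [∀ l, Module A (P l)]
    (dP : ∀ l, P (l + 1) →ₗ[A] P l)
    {B : Type*} [Ring B] (P' : ℕ → Type*) [∀ l, AddCommGroup (P' l)] [∀ l, Module B (P' l)]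
    (dP' : ∀ l, P' (l + 1) →ₗ[B] P' l)
    (K : Type*) [Field K] [Algebra K A] [Algebra K B]
    [∀ l, Module K (P l)] [∀ l, IsScalarTower K A (P l)] [∀ l, SMulCommClass A K (P l)]
    [∀ l, Module K (P' l)] [∀ l, IsScalarTower K B (P' l)] [∀ l, SMulCommClass B K (P' l)]
    (φ : ∀ k, extQ P dP K k ≃ₗ[K] extQ P' dP' K k) : Prop :=
  (∀ (hid : IsChainMap P dP 0 (extId P)) (hid' : IsChainMap P' dP' 0 (extId P')),
      φ 0 (extMk P dP K 0 (extId P) hid) = extMk P' dP' K 0 (extId P') hid') ∧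
  (∀ (j k : ℕ) (x : ExtDeg A P j) (y : ExtDeg A P k)
      (hx : IsChainMap P dP j x) (hy : IsChainMap P dP k y)
      (hxy : IsChainMap P dP (j + k) (extComp P x y))
      (x' : ExtDeg B P' j) (y' : ExtDeg B P' k)
      (hx' : IsChainMap P' dP' j x') (hy' : IsChainMap P' dP' k y')
      (hxy' : IsChainMap P' dP' (j + k) (extComp P' x' y')),
      φ j (extMk P dP K j x hx) = extMk P' dP' K j x' hx' →
      φ k (extMk P dP K k y hy) = extMk P' dP' K k y' hy' →
      φ (j + k) (extMk P dP K (j + k) (extComp P x y) hxy) =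
        extMk P' dP' K (j + k) (extComp P' x' y') hxy')

section Resolutions

theorem exists_dependent_seq {S : ℕ → Type*} (r : ∀ m, S m → S (m + 1) → Prop) (s₀ : S 0)
    (step : ∀ m s, ∃ t, r m s t) :
    ∃ s : ∀ m, S m, s 0 = s₀ ∧ ∀ m, r m (s m) (s (m + 1)) := by
  choose nxt hnxt using step
  exact ⟨fun m => Nat.rec s₀ (fun m s => nxt m s) m, rfl, fun m => hnxt m _⟩

variable {B : Type*} [Ring B]

theorem exists_lift_of_exact {X Y₁ Y₀ Z : Type*} [AddCommGroup X] [Module B X]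
    [AddCommGroup Y₁] [Module B Y₁] [AddCommGroup Y₀] [Module B Y₀] [AddCommGroup Z] [Module B Z]
    [Module.Projective B X] (f : Y₁ →ₗ[B] Y₀) (g : Y₀ →ₗ[B] Z) (hfg : Function.Exact f g)
    (c : X →ₗ[B] Y₀) (hc : g ∘ₗ c = 0) : ∃ l : X →ₗ[B] Y₁, f ∘ₗ l = c := by
  have hmem : ∀ x, c x ∈ LinearMap.range f := fun x =>
    (hfg (c x)).1 (LinearMap.congr_fun hc x)
  obtain ⟨l, hl⟩ := Module.projective_lifting_property f.rangeRestrict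
    (c.codRestrict _ hmem) f.surjective_rangeRestrict
  refine ⟨l, LinearMap.ext fun x => ?_⟩
  exact congrArg Subtype.val (LinearMap.congr_fun hl x)

variable {X Y : ℕ → Type*} [∀ m, AddCommGroup (X m)] [∀ m, Module B (X m)]
  [∀ m, AddCommGroup (Y m)] [∀ m, Module B (Y m)] {N : Type*} [AddCommGroup N] [Module B N]

theorem exists_chain_lift (hX : ∀ m, Module.Projective B (X m)) (dX : ∀ m, X (m + 1) →ₗ[B] X m)
    (hdX : ∀ m, dX m ∘ₗ dX (m + 1) = 0) (dY : ∀ m, Y (m + 1) →ₗ[B] Y m) (π : Y 0 →ₗ[B] N)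
    (hπ : Function.Surjective π) (hex0 : Function.Exact (dY 0) π)
    (hex : ∀ m, Function.Exact (dY (m + 1)) (dY m)) (f : X 0 →ₗ[B] N) (hf : f ∘ₗ dX 0 = 0) :
    ∃ g : ∀ m, X m →ₗ[B] Y m, π ∘ₗ g 0 = f ∧ ∀ m, g m ∘ₗ dX m = dY m ∘ₗ g (m + 1) := by
  let S : ℕ → Type _ := fun m =>
    {p : (X m →ₗ[B] Y m) × (X (m + 1) →ₗ[B] Y (m + 1)) // p.1 ∘ₗ dX m = dY m ∘ₗ p.2}
  obtain ⟨g₀, hg₀⟩ := Module.projective_lifting_property π f hπ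
  obtain ⟨g₁, hg₁⟩ := exists_lift_of_exact (dY 0) π hex0 (g₀ ∘ₗ dX 0)
    (by rw [← LinearMap.comp_assoc, hg₀, hf])
  obtain ⟨s, hs0, hs⟩ := exists_dependent_seq (S := S) (fun m s t => s.1.2 = t.1.1)
    ⟨(g₀, g₁), hg₁.symm⟩ (by
      rintro m ⟨⟨a, b⟩, hab⟩
      obtain ⟨c, hc⟩ := exists_lift_of_exact (dY (m + 1)) (dY m) (hex m) (b ∘ₗ dX (m + 1))
        (by
          have hab' : a ∘ₗ dX m = dY m ∘ₗ b := hab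
          rw [← LinearMap.comp_assoc, ← hab', LinearMap.comp_assoc, hdX, LinearMap.comp_zero])
      exact ⟨⟨(b, c), hc.symm⟩, rfl⟩)
  refine ⟨fun m => (s m).1.1, ?_, fun m => ?_⟩
  · simp only [hs0, hg₀]
  · show (s m).1.1 ∘ₗ dX m = dY m ∘ₗ (s (m + 1)).1.1
    rw [← hs m]
    exact (s m).2

theorem exists_homotopy (hX : ∀ m, Module.Projective B (X m)) (dX : ∀ m, X (m + 1) →ₗ[B] X m)
    (hdX : ∀ m, dX m ∘ₗ dX (m + 1) = 0) (dY : ∀ m, Y (m + 1) →ₗ[B] Y m) (π : Y 0 →ₗ[B] N)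
    (hex0 : Function.Exact (dY 0) π)
    (hex : ∀ m, Function.Exact (dY (m + 1)) (dY m)) (g : ∀ m, X m →ₗ[B] Y m)
    (hg : ∀ m, g m ∘ₗ dX m = dY m ∘ₗ g (m + 1)) (w : X 0 →ₗ[B] Y 0) (hw : w ∘ₗ dX 0 = 0)
    (hgw : π ∘ₗ g 0 = π ∘ₗ w) :
    ∃ h : ∀ m, X m →ₗ[B] Y (m + 1), g 0 = w + dY 0 ∘ₗ h 0 ∧
      ∀ m, g (m + 1) = dY (m + 1) ∘ₗ h (m + 1) + h m ∘ₗ dX m := by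
  let S : ℕ → Type _ := fun m =>
    {h : X m →ₗ[B] Y (m + 1) // (dY m ∘ₗ h) ∘ₗ dX m = g m ∘ₗ dX m}
  obtain ⟨h₀, hh₀⟩ := exists_lift_of_exact (dY 0) π hex0 (g 0 - w)
    (by rw [LinearMap.comp_sub, hgw, sub_self])
  obtain ⟨s, hs0, hs⟩ := exists_dependent_seq (S := S)
    (fun m s t => dY (m + 1) ∘ₗ t.1 = g (m + 1) - s.1 ∘ₗ dX m)
    ⟨h₀, by rw [hh₀, LinearMap.sub_comp, hw, sub_zero]⟩ (by
      rintro m ⟨a, ha⟩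
      obtain ⟨c, hc⟩ := exists_lift_of_exact (dY (m + 1)) (dY m) (hex m)
        (g (m + 1) - a ∘ₗ dX m)
        (by rw [LinearMap.comp_sub, ← LinearMap.comp_assoc, ha, hg, sub_self])
      exact ⟨⟨c, by rw [hc, LinearMap.sub_comp, LinearMap.comp_assoc, hdX, LinearMap.comp_zero,
        sub_zero]⟩, hc⟩)
  refine ⟨fun m => (s m).1, ?_, fun m => ?_⟩
  · simp only [hs0, hh₀]
    abel
  · simp only [hs m]
    abel

end Resolutions

section Coboundaries

variable {B : Type*} [Ring B] {X Y : ℕ → Type*} [∀ m, AddCommGroup (X m)] [∀ m, Module B (X m)]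
  [∀ m, AddCommGroup (Y m)] [∀ m, Module B (Y m)]
  {N : Type*} [AddCommGroup N] [Module B N] {N' : Type*} [AddCommGroup N'] [Module B N']

/-- `f : X_k → N` is a coboundary of the complex `Hom(X•, N)`. -/
def IsCoboundary (dX : ∀ m, X (m + 1) →ₗ[B] X m) : (k : ℕ) → (X k →ₗ[B] N) → Prop
  | 0, f => f = 0
  | k + 1, f => ∃ u : X k →ₗ[B] N, f = u ∘ₗ dX k

variable {dX : ∀ m, X (m + 1) →ₗ[B] X m} {dY : ∀ m, Y (m + 1) →ₗ[B] Y m}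

theorem IsCoboundary.zero (k : ℕ) : IsCoboundary dX k (0 : X k →ₗ[B] N) := by
  cases k with
  | zero => rfl
  | succ k => exact ⟨0, by simp⟩

theorem IsCoboundary.add {k : ℕ} {f g : X k →ₗ[B] N} (hf : IsCoboundary dX k f)
    (hg : IsCoboundary dX k g) : IsCoboundary dX k (f + g) := by
  cases k with
  | zero =>
    have h₁ : f = 0 := hf
    have h₂ : g = 0 := hg
    show f + g = 0
    rw [h₁, h₂, add_zero]
  | succ k =>
    obtain ⟨u, rfl⟩ := hf
    obtain ⟨v, rfl⟩ := hg
    exact ⟨u + v, by rw [LinearMap.add_comp]⟩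

theorem IsCoboundary.comp_left {k : ℕ} {f : X k →ₗ[B] N} (hf : IsCoboundary dX k f)
    (a : N →ₗ[B] N') : IsCoboundary dX k (a ∘ₗ f) := by
  cases k with
  | zero =>
    have h₁ : f = 0 := hf
    show a ∘ₗ f = 0
    rw [h₁, LinearMap.comp_zero]
  | succ k =>
    obtain ⟨u, rfl⟩ := hf
    exact ⟨a ∘ₗ u, by rw [LinearMap.comp_assoc]⟩

theorem IsCoboundary.neg {k : ℕ} {f : X k →ₗ[B] N} (hf : IsCoboundary dX k f) :
    IsCoboundary dX k (-f) := by
  simpa [LinearMap.neg_comp] using hf.comp_left (-LinearMap.id)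

theorem IsCoboundary.sub {k : ℕ} {f g : X k →ₗ[B] N} (hf : IsCoboundary dX k f)
    (hg : IsCoboundary dX k g) : IsCoboundary dX k (f - g) := by
  rw [sub_eq_add_neg]
  exact hf.add hg.neg

theorem IsCoboundary.smul {S : Type*} [Monoid S] [DistribMulAction S N] [SMulCommClass B S N]
    {k : ℕ} {f : X k →ₗ[B] N} (hf : IsCoboundary dX k f) (c : S) :
    IsCoboundary dX k (c • f) := by
  cases k with
  | zero =>
    have h₁ : f = 0 := hf
    show c • f = 0
    rw [h₁, smul_zero]
  | succ k =>
    obtain ⟨u, rfl⟩ := hf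
    exact ⟨c • u, by rw [LinearMap.smul_comp]⟩

theorem IsCoboundary.comp_d (hdX : ∀ m, dX m ∘ₗ dX (m + 1) = 0) {k : ℕ} {f : X k →ₗ[B] N}
    (hf : IsCoboundary dX k f) : f ∘ₗ dX k = 0 := by
  cases k with
  | zero =>
    have h₁ : f = 0 := hf
    rw [h₁, LinearMap.zero_comp]
  | succ k =>
    obtain ⟨u, rfl⟩ := hf
    rw [LinearMap.comp_assoc, hdX, LinearMap.comp_zero]

theorem IsCoboundary.comp_chain {k : ℕ} {f : Y k →ₗ[B] N} (hf : IsCoboundary dY k f)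
    (g : ∀ m, X m →ₗ[B] Y m) (hg : ∀ m, g m ∘ₗ dX m = dY m ∘ₗ g (m + 1)) :
    IsCoboundary dX k (f ∘ₗ g k) := by
  cases k with
  | zero =>
    have h₁ : f = 0 := hf
    show f ∘ₗ g 0 = 0
    rw [h₁, LinearMap.zero_comp]
  | succ k =>
    obtain ⟨u, rfl⟩ := hf
    exact ⟨u ∘ₗ g k, by rw [LinearMap.comp_assoc, ← hg, LinearMap.comp_assoc]⟩

theorem IsCoboundary.exists_lift (hX : ∀ m, Module.Projective B (X m)) {k : ℕ} (p : N' →ₗ[B] N)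
    (hp : Function.Surjective p) {f : X k →ₗ[B] N} (hf : IsCoboundary dX k f) :
    ∃ w : X k →ₗ[B] N', IsCoboundary dX k w ∧ p ∘ₗ w = f := by
  cases k with
  | zero =>
    have h₁ : f = 0 := hf
    exact ⟨0, IsCoboundary.zero 0, by rw [h₁, LinearMap.comp_zero]⟩
  | succ k =>
    obtain ⟨u, rfl⟩ := hf
    obtain ⟨v, rfl⟩ := Module.projective_lifting_property p u hp
    exact ⟨v ∘ₗ dX k, ⟨v, rfl⟩, by rw [LinearMap.comp_assoc]⟩

/-- `g` is a chain map `X• → Y•[k]`. -/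
def IsShiftMap (dX : ∀ m, X (m + 1) →ₗ[B] X m) (dY : ∀ m, Y (m + 1) →ₗ[B] Y m) (k : ℕ)
    (g : ∀ m, X (k + m) →ₗ[B] Y m) : Prop :=
  ∀ m, g m ∘ₗ dX (k + m) = ((-1 : ℤ) ^ k) • (dY m ∘ₗ g (m + 1))

theorem neg_one_pow_smul_smul {V : Type*} [AddCommGroup V] (k : ℕ) (v : V) :
    ((-1 : ℤ) ^ k) • ((-1 : ℤ) ^ k) • v = v := by
  rw [smul_smul, ← mul_pow]; simp

theorem IsShiftMap.smul_d {k : ℕ} {g : ∀ m, X (k + m) →ₗ[B] Y m} (hg : IsShiftMap dX dY k g)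
    (m : ℕ) : g m ∘ₗ (((-1 : ℤ) ^ k) • dX (k + m)) = dY m ∘ₗ g (m + 1) := by
  rw [LinearMap.comp_smul, hg m, neg_one_pow_smul_smul]

theorem IsCoboundary.comp_shift {k j : ℕ} {g : ∀ m, X (k + m) →ₗ[B] Y m}
    (hg : IsShiftMap dX dY k g) {b : Y j →ₗ[B] N} (hb : IsCoboundary dY j b) :
    IsCoboundary dX (k + j) (b ∘ₗ g j) := by
  cases j with
  | zero =>
    have h₁ : b = 0 := hb
    rw [h₁, LinearMap.zero_comp]
    exact IsCoboundary.zero _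
  | succ j =>
    obtain ⟨u, rfl⟩ := hb
    refine ⟨((-1 : ℤ) ^ k) • (u ∘ₗ g j), ?_⟩
    rw [LinearMap.comp_assoc, ← hg.smul_d, LinearMap.comp_smul, LinearMap.comp_smul,
      LinearMap.smul_comp]
    rfl

/-- A shifted chain map whose augmentation is a coboundary is null-homotopic. -/
theorem IsShiftMap.exists_homotopy (hX : ∀ m, Module.Projective B (X m))
    (hdX : ∀ m, dX m ∘ₗ dX (m + 1) = 0) (π : Y 0 →ₗ[B] N) (hπ : Function.Surjective π)
    (hex0 : Function.Exact (dY 0) π) (hex : ∀ m, Function.Exact (dY (m + 1)) (dY m))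
    {k : ℕ} {g : ∀ m, X (k + m) →ₗ[B] Y m} (hg : IsShiftMap dX dY k g)
    (hb : IsCoboundary dX k (π ∘ₗ g 0 : X k →ₗ[B] N)) :
    ∃ (w : X k →ₗ[B] Y 0) (h : ∀ m, X (k + m) →ₗ[B] Y (m + 1)), IsCoboundary dX k w ∧
      g 0 = w + dY 0 ∘ₗ h 0 ∧
      ∀ m, g (m + 1) = dY (m + 1) ∘ₗ h (m + 1) + ((-1 : ℤ) ^ k) • (h m ∘ₗ dX (k + m)) := by
  obtain ⟨w, hw, hπw⟩ := hb.exists_lift hX π hπ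
  obtain ⟨h, h0, hs⟩ := _root_.exists_homotopy (X := fun m => X (k + m)) (fun m => hX _)
    (fun m => ((-1 : ℤ) ^ k) • dX (k + m))
    (fun m => by
      rw [LinearMap.comp_smul, LinearMap.smul_comp]
      have := hdX (k + m)
      rw [show dX (k + m) ∘ₗ dX (k + (m + 1)) = 0 from this, smul_zero, smul_zero])
    dY π hex0 hex g hg.smul_d w
    (by
      have := hw.comp_d hdX
      rw [LinearMap.comp_smul, show w ∘ₗ dX (k + 0) = 0 from this, smul_zero])
    hπw.symm
  refine ⟨w, h, hw, h0, fun m => ?_⟩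
  rw [hs m, LinearMap.comp_smul]

theorem IsShiftMap.isCoboundary_comp (hX : ∀ m, Module.Projective B (X m))
    (hdX : ∀ m, dX m ∘ₗ dX (m + 1) = 0) (π : Y 0 →ₗ[B] N) (hπ : Function.Surjective π)
    (hex0 : Function.Exact (dY 0) π) (hex : ∀ m, Function.Exact (dY (m + 1)) (dY m))
    {k : ℕ} {g : ∀ m, X (k + m) →ₗ[B] Y m} (hg : IsShiftMap dX dY k g)
    (hb : IsCoboundary dX k (π ∘ₗ g 0 : X k →ₗ[B] N)) {j : ℕ} (c : Y j →ₗ[B] N')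
    (hc : c ∘ₗ dY j = 0) : IsCoboundary dX (k + j) (c ∘ₗ g j) := by
  obtain ⟨w, h, hw, h0, hs⟩ := hg.exists_homotopy hX hdX π hπ hex0 hex hb
  cases j with
  | zero =>
    have hcw : c ∘ₗ g 0 = c ∘ₗ w := by
      rw [h0, LinearMap.comp_add, ← LinearMap.comp_assoc, hc, LinearMap.zero_comp]
      exact add_zero _
    rw [hcw]
    exact hw.comp_left c
  | succ j =>
    refine ⟨((-1 : ℤ) ^ k) • (c ∘ₗ h j), ?_⟩
    rw [hs, LinearMap.comp_add, ← LinearMap.comp_assoc, hc, LinearMap.zero_comp, zero_add,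
      LinearMap.comp_smul, LinearMap.smul_comp]
    rfl

theorem isCoboundary_comp_sub_self (hX : ∀ m, Module.Projective B (X m)) (π : X 0 →ₗ[B] N)
    (hex0 : Function.Exact (dX 0) π) (hex : ∀ m, Function.Exact (dX (m + 1)) (dX m))
    (γ : ∀ m, X m →ₗ[B] X m) (hγ : ∀ m, γ m ∘ₗ dX m = dX m ∘ₗ γ (m + 1)) (hπγ : π ∘ₗ γ 0 = π)
    {k : ℕ} (c : X k →ₗ[B] N') (hc : c ∘ₗ dX k = 0) : IsCoboundary dX k (c ∘ₗ γ k - c) := by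
  obtain ⟨h, h0, hs⟩ := exists_homotopy hX dX (fun m => (hex m).linearMap_comp_eq_zero) dX π
    hex0 hex (fun m => γ m - LinearMap.id)
    (fun m => by rw [LinearMap.sub_comp, LinearMap.comp_sub, hγ]; rfl) 0 (by simp)
    (by rw [LinearMap.comp_sub, hπγ]; simp)
  have hcs : c ∘ₗ γ k - c = c ∘ₗ (γ k - LinearMap.id) := by
    rw [LinearMap.comp_sub, LinearMap.comp_id]
  rw [hcs]
  cases k with
  | zero =>
    show _ = _
    rw [h0, zero_add, ← LinearMap.comp_assoc, hc, LinearMap.zero_comp]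
  | succ k =>
    refine ⟨c ∘ₗ h k, ?_⟩
    rw [hs, LinearMap.comp_add, ← LinearMap.comp_assoc, hc, LinearMap.zero_comp, zero_add,
      LinearMap.comp_assoc]

/-- Comparison of projective resolutions: composition with a chain map over the identity is
bijective on cohomology. -/
theorem comparison_of_resolutions (hX : ∀ m, Module.Projective B (X m)) (hY : ∀ m, Module.Projective B (Y m))
    (πX : X 0 →ₗ[B] N) (hπX : Function.Surjective πX)
    (hX0 : Function.Exact (dX 0) πX) (hX1 : ∀ m, Function.Exact (dX (m + 1)) (dX m))
    (πY : Y 0 →ₗ[B] N)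
    (hY0 : Function.Exact (dY 0) πY) (hY1 : ∀ m, Function.Exact (dY (m + 1)) (dY m))
    (α : ∀ m, X m →ₗ[B] Y m) (hα : ∀ m, α m ∘ₗ dX m = dY m ∘ₗ α (m + 1))
    (hπα : πY ∘ₗ α 0 = πX) (k : ℕ) :
    (∀ c : Y k →ₗ[B] N', c ∘ₗ dY k = 0 → IsCoboundary dX k (c ∘ₗ α k) → IsCoboundary dY k c) ∧
    (∀ c' : X k →ₗ[B] N', c' ∘ₗ dX k = 0 →
      ∃ c : Y k →ₗ[B] N', c ∘ₗ dY k = 0 ∧ IsCoboundary dX k (c ∘ₗ α k - c')) := by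
  have hdX : ∀ m, dX m ∘ₗ dX (m + 1) = 0 := fun m => (hX1 m).linearMap_comp_eq_zero
  have hdY : ∀ m, dY m ∘ₗ dY (m + 1) = 0 := fun m => (hY1 m).linearMap_comp_eq_zero
  obtain ⟨β, hπβ, hβ⟩ := exists_chain_lift hY dY hdY dX πX hπX hX0 hX1 πY
    hY0.linearMap_comp_eq_zero
  constructor
  · intro c hc hcα
    have h₁ := isCoboundary_comp_sub_self hY πY hY0 hY1 (fun m => α m ∘ₗ β m)
      (fun m => by rw [LinearMap.comp_assoc, hβ, ← LinearMap.comp_assoc, hα, LinearMap.comp_assoc])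
      (by rw [← LinearMap.comp_assoc, hπα, hπβ]) c hc
    have h₂ := (hcα.comp_chain β hβ).sub h₁
    rwa [LinearMap.comp_assoc, sub_sub_cancel] at h₂
  · intro c' hc'
    have h₁ := isCoboundary_comp_sub_self hX πX hX0 hX1 (fun m => β m ∘ₗ α m)
      (fun m => by rw [LinearMap.comp_assoc, hα, ← LinearMap.comp_assoc, hβ, LinearMap.comp_assoc])
      (by rw [← LinearMap.comp_assoc, hπβ, hπα]) c' hc'
    refine ⟨c' ∘ₗ β k, ?_, h₁⟩
    rw [LinearMap.comp_assoc, hβ, ← LinearMap.comp_assoc, hc', LinearMap.zero_comp]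

end Coboundaries

section ExtCohomology

theorem exists_subquotient_equiv {K V V' : Type*} [Field K] [AddCommGroup V] [Module K V]
    [AddCommGroup V'] [Module K V'] (Z C : Submodule K V) (Z' C' : Submodule K V')
    (f : V →ₗ[K] V') (hZ : ∀ z ∈ Z, f z ∈ Z') (hC : ∀ z ∈ Z, f z ∈ C' ↔ z ∈ C)
    (hs : ∀ z' ∈ Z', ∃ z ∈ Z, f z - z' ∈ C') :
    ∃ ψ : (↥Z ⧸ C.comap Z.subtype) ≃ₗ[K] (↥Z' ⧸ C'.comap Z'.subtype),
      ∀ z (hz : z ∈ Z), ψ (Submodule.Quotient.mk ⟨z, hz⟩) =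
        Submodule.Quotient.mk ⟨f z, hZ z hz⟩ := by
  let F : (↥Z ⧸ C.comap Z.subtype) →ₗ[K] (↥Z' ⧸ C'.comap Z'.subtype) :=
    Submodule.mapQ _ _ (f.restrict hZ) fun z hz => (hC z.1 z.2).2 hz
  have hF : Function.Bijective F := by
    constructor
    · rw [injective_iff_map_eq_zero]
      intro x hx
      obtain ⟨z, rfl⟩ := Submodule.Quotient.mk_surjective _ x
      rw [Submodule.Quotient.mk_eq_zero]
      have h₁ := (Submodule.Quotient.mk_eq_zero _).1 hx
      exact (hC z.1 z.2).1 h₁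
    · intro x
      obtain ⟨z', rfl⟩ := Submodule.Quotient.mk_surjective _ x
      obtain ⟨z, hz, h⟩ := hs z'.1 z'.2
      exact ⟨Submodule.Quotient.mk ⟨z, hz⟩, (Submodule.Quotient.eq _).2 h⟩
  exact ⟨LinearEquiv.ofBijective F hF, fun z hz => rfl⟩

variable {A : Type*} [Ring A] {P : ℕ → Type*} [∀ l, AddCommGroup (P l)] [∀ l, Module A (P l)]
  {N : Type*} [AddCommGroup N] [Module A N]

theorem pcast_comp_pcast {a b c : ℕ} (h : a = b) (h' : b = c) :
    (pcast P h' : P b →ₗ[A] P c) ∘ₗ pcast P h = pcast P (h.trans h') := by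
  subst h h'
  rfl

theorem pcast_comp_pcast_comp {a b c : ℕ} (h : a = b) (h' : b = c) (f : N →ₗ[A] P a) :
    (pcast P h' : P b →ₗ[A] P c) ∘ₗ (pcast P h ∘ₗ f) = pcast P (h.trans h') ∘ₗ f := by
  subst h h'
  rfl

theorem pcast_naturality {Q : ℕ → Type*} [∀ l, AddCommGroup (Q l)] [∀ l, Module A (Q l)]
    {s t : ℕ → ℕ} (g : ∀ m, P (s m) →ₗ[A] Q (t m)) {a b : ℕ} (h : a = b) :
    g b ∘ₗ pcast P (congrArg s h) = pcast Q (congrArg t h) ∘ₗ g a := by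
  subst h
  rfl

variable {dP : ∀ l, P (l + 1) →ₗ[A] P l}

theorem IsCoboundary.comp_pcast {a b : ℕ} (h : a = b) {f : P b →ₗ[A] N}
    (hf : IsCoboundary dP b f) : IsCoboundary dP a (f ∘ₗ pcast P h) := by
  subst h
  exact hf

theorem IsNullMap.isCoboundary {π : P 0 →ₗ[A] N} (hπ : π ∘ₗ dP 0 = 0) {k : ℕ}
    {g : ExtDeg A P k} (hg : IsNullMap P dP k g) :
    IsCoboundary dP k (π ∘ₗ g 0 : P k →ₗ[A] N) := by
  cases k with
  | zero =>
    obtain ⟨h, h0, -⟩ := hg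
    show _ = _
    rw [h0, ← LinearMap.comp_assoc, hπ, LinearMap.zero_comp]
  | succ k =>
    obtain ⟨h, hs⟩ := hg
    refine ⟨-(((-1 : ℤ) ^ k) • (π ∘ₗ h 0)), ?_⟩
    rw [hs 0, LinearMap.comp_sub, ← LinearMap.comp_assoc, ← LinearMap.comp_assoc, hπ,
      LinearMap.zero_comp, LinearMap.zero_comp, zero_sub, LinearMap.comp_smul,
      LinearMap.neg_comp, LinearMap.smul_comp]
    rfl

theorem IsChainMap.isNullMap (hP : ∀ m, Module.Projective A (P m)) (π : P 0 →ₗ[A] N)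
    (hπ : Function.Surjective π) (hex0 : Function.Exact (dP 0) π)
    (hex : ∀ m, Function.Exact (dP (m + 1)) (dP m)) {k : ℕ}
    {g : ExtDeg A P k} (hg : IsChainMap P dP k g)
    (hb : IsCoboundary dP k (π ∘ₗ g 0 : P k →ₗ[A] N)) : IsNullMap P dP k g := by
  obtain ⟨w, h, hw, h0, hs⟩ := IsShiftMap.exists_homotopy hP
    (fun m => (hex m).linearMap_comp_eq_zero) π hπ hex0 hex hg hb
  cases k with
  | zero =>
    have hw0 : w = 0 := hw
    refine ⟨fun m => h m ∘ₗ pcast P (by omega : m = 0 + m), ?_, fun m => ?_⟩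
    · rw [h0, hw0]
      exact zero_add _
    · rw [hs m, LinearMap.add_comp, LinearMap.comp_assoc, LinearMap.comp_assoc,
        pcast_comp_pcast, LinearMap.comp_assoc, LinearMap.comp_assoc,
        pcast_naturality (s := fun m => m + 1) (t := fun m => m) dP (by omega : 0 + m = m),
        pcast_comp_pcast_comp, pow_zero, one_smul]
      rfl
  | succ k =>
    obtain ⟨u, rfl⟩ := hw
    refine ⟨fun m => match m with
      | 0 => ((-1 : ℤ) ^ (k + 1)) • u
      | m + 1 => h m ∘ₗ pcast P (by omega : k + (m + 1) = (k + 1) + m), fun m => ?_⟩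
    have hneg : ∀ {V : Type _} [AddCommGroup V] (v : V),
        ((-1 : ℤ) ^ (k + 1)) • v = -(((-1 : ℤ) ^ k) • v) := fun v => by
      rw [pow_succ, mul_neg_one, neg_smul]
    cases m with
    | zero =>
      rw [h0, LinearMap.comp_assoc, LinearMap.comp_assoc, pcast_comp_pcast]
      simp only
      rw [LinearMap.smul_comp, LinearMap.smul_comp, hneg, smul_neg, neg_one_pow_smul_smul,
        sub_neg_eq_add]
      exact add_comm _ _
    | succ m =>
      rw [hs m, LinearMap.comp_assoc, LinearMap.comp_assoc, pcast_comp_pcast, hneg,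
        ← sub_eq_add_neg, LinearMap.comp_assoc, LinearMap.comp_assoc,
        pcast_naturality (s := fun m => m + 1) (t := fun m => m) dP
          (by omega : k + 1 + m = k + (m + 1)),
        pcast_comp_pcast_comp]
      rfl

variable (K : Type*) [Field K]

/-- The `K`-space of degree-`k` cocycles of `Hom(P•, N)`. -/
def cocycles (dP : ∀ l, P (l + 1) →ₗ[A] P l) (N : Type*) [AddCommGroup N] [Module A N]
    [Module K N] [SMulCommClass A K N] (k : ℕ) : Submodule K (P k →ₗ[A] N) where
  carrier := {f | f ∘ₗ dP k = 0}
  add_mem' {f g} hf hg := by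
    have h₁ : f ∘ₗ dP k = 0 := hf
    have h₂ : g ∘ₗ dP k = 0 := hg
    show (f + g) ∘ₗ dP k = 0
    rw [LinearMap.add_comp, h₁, h₂, add_zero]
  zero_mem' := LinearMap.zero_comp _
  smul_mem' c f hf := by
    have h₁ : f ∘ₗ dP k = 0 := hf
    show (c • f) ∘ₗ dP k = 0
    rw [LinearMap.smul_comp, h₁, smul_zero]

/-- The `K`-space of degree-`k` coboundaries of `Hom(P•, N)`. -/
def coboundaries (dP : ∀ l, P (l + 1) →ₗ[A] P l) (N : Type*) [AddCommGroup N] [Module A N]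
    [Module K N] [SMulCommClass A K N] (k : ℕ) : Submodule K (P k →ₗ[A] N) where
  carrier := {f | IsCoboundary dP k f}
  add_mem' hf hg := IsCoboundary.add hf hg
  zero_mem' := IsCoboundary.zero k
  smul_mem' c _ hf := IsCoboundary.smul hf c

variable [Algebra K A] [∀ l, Module K (P l)] [∀ l, IsScalarTower K A (P l)]
  [∀ l, SMulCommClass A K (P l)] [Module K N] [IsScalarTower K A N] [SMulCommClass A K N]

theorem isChainMap_of_mem_chainSub {k : ℕ} {g : ExtDeg A P k} (hg : g ∈ chainSub P dP K k) :
    IsChainMap P dP k g := by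
  refine Submodule.span_induction (fun g hg => hg) ?_ ?_ ?_ hg
  · intro m
    simp
  · intro x y _ _ hx hy m
    have h₁ := hx m
    have h₂ := hy m
    simp only [Pi.add_apply, LinearMap.add_comp, LinearMap.comp_add, smul_add, h₁, h₂]
  · intro c x _ hx m
    have h₁ := hx m
    simp only [Pi.smul_apply, LinearMap.smul_comp, LinearMap.comp_smul, h₁]
    rw [smul_comm]

/-- Composition of the lowest component with the augmentation. -/
def augmentation (π : P 0 →ₗ[A] N) (k : ℕ) : ExtDeg A P k →ₗ[K] (P k →ₗ[A] N) where
  toFun g := π ∘ₗ g 0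
  map_add' _ _ := LinearMap.comp_add _ _ _
  map_smul' _ _ := LinearMap.comp_smul _ _ _

theorem IsChainMap.augmentation_comp_d {π : P 0 →ₗ[A] N} (hπ : π ∘ₗ dP 0 = 0) {k : ℕ}
    {g : ExtDeg A P k} (hg : IsChainMap P dP k g) : augmentation K π k g ∘ₗ dP k = 0 := by
  have h : (π ∘ₗ g 0) ∘ₗ dP (k + 0) = 0 := by
    rw [LinearMap.comp_assoc, hg 0, LinearMap.comp_smul, ← LinearMap.comp_assoc, hπ,
      LinearMap.zero_comp, smul_zero]
  exact h

/-- `Ext^k`, defined by chain maps up to homotopy, is identified with any subquotient that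
represents cocycles modulo coboundaries. -/
theorem exists_extQ_equiv (hP : ∀ m, Module.Projective A (P m)) (π : P 0 →ₗ[A] N)
    (hπ : Function.Surjective π) (hex0 : Function.Exact (dP 0) π)
    (hex : ∀ m, Function.Exact (dP (m + 1)) (dP m)) (k : ℕ) {V : Type*} [AddCommGroup V]
    [Module K V] (Z C : Submodule K V) (f : (P k →ₗ[A] N) →ₗ[K] V)
    (hZ : ∀ c, c ∘ₗ dP k = 0 → f c ∈ Z)
    (hC : ∀ c, c ∘ₗ dP k = 0 → (f c ∈ C ↔ IsCoboundary dP k c))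
    (hs : ∀ z ∈ Z, ∃ c, c ∘ₗ dP k = 0 ∧ f c - z ∈ C) :
    ∃ ψ : extQ P dP K k ≃ₗ[K] (↥Z ⧸ C.comap Z.subtype), ∀ g (hg : IsChainMap P dP k g),
      ψ (extMk P dP K k g hg) = Submodule.Quotient.mk ⟨f (augmentation K π k g),
        hZ _ (hg.augmentation_comp_d K hex0.linearMap_comp_eq_zero)⟩ := by
  have hπd := hex0.linearMap_comp_eq_zero
  obtain ⟨ψ, hψ⟩ := exists_subquotient_equiv (chainSub P dP K k) (nullSub P dP K k) Z C
    (f ∘ₗ augmentation K π k)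
    (fun g hg => hZ _ ((isChainMap_of_mem_chainSub K hg).augmentation_comp_d K hπd))
    (fun g hg => by
      have hg' := isChainMap_of_mem_chainSub K hg
      rw [LinearMap.comp_apply, hC _ (hg'.augmentation_comp_d K hπd)]
      constructor
      · intro h
        exact Submodule.subset_span (hg'.isNullMap hP π hπ hex0 hex h)
      · intro h
        have hle : nullSub P dP K k ≤ (coboundaries K dP N k).comap (augmentation K π k) :=
          Submodule.span_le.2 fun x hx => IsNullMap.isCoboundary hπd hx
        exact hle h)
    (fun z hz => by
      obtain ⟨c, hc, hcz⟩ := hs z hz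
      have hdP : ∀ m, dP m ∘ₗ dP (m + 1) = 0 := fun m => (hex m).linearMap_comp_eq_zero
      obtain ⟨g, hg0, hg⟩ := exists_chain_lift (X := fun m => P (k + m)) (fun m => hP _)
        (fun m => ((-1 : ℤ) ^ k) • dP (k + m))
        (fun m => by
          rw [LinearMap.comp_smul, LinearMap.smul_comp,
            show dP (k + m) ∘ₗ dP (k + (m + 1)) = 0 from hdP (k + m), smul_zero, smul_zero])
        dP π hπ hex0 hex c
        (by rw [LinearMap.comp_smul, show c ∘ₗ dP (k + 0) = 0 from hc, smul_zero])
      have hchain : IsChainMap P dP k g := fun m => by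
        rw [← hg m, LinearMap.comp_smul, neg_one_pow_smul_smul]
      refine ⟨g, Submodule.subset_span hchain, ?_⟩
      have : augmentation K π k g = c := hg0
      rwa [LinearMap.comp_apply, this])
  exact ⟨ψ, fun g hg => hψ g _⟩

end ExtCohomology

section HomFunctor

variable {R : Type*} [Ring R] (D : Type*) [AddCommGroup D] [Module R D]

/-- Postcomposition with `f`, as a homomorphism of `End(D)ᵒᵖ`-modules. -/
def homPost {M N : Type*} [AddCommGroup M] [Module R M] [AddCommGroup N] [Module R N]
    (f : M →ₗ[R] N) : (D →ₗ[R] M) →ₗ[(Module.End R D)ᵐᵒᵖ] (D →ₗ[R] N) where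
  toFun g := f ∘ₗ g
  map_add' _ _ := LinearMap.comp_add _ _ _
  map_smul' _ _ := rfl

section Basic

variable {M N L : Type*} [AddCommGroup M] [Module R M] [AddCommGroup N] [Module R N]
  [AddCommGroup L] [Module R L]

@[simp]
theorem homPost_apply (f : M →ₗ[R] N) (g : D →ₗ[R] M) : homPost D f g = f ∘ₗ g := rfl

theorem homPost_comp (g : N →ₗ[R] L) (f : M →ₗ[R] N) :
    homPost D (g ∘ₗ f) = homPost D g ∘ₗ homPost D f := rfl

theorem homPost_add (f g : M →ₗ[R] N) : homPost D (f + g) = homPost D f + homPost D g :=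
  LinearMap.ext fun _ => LinearMap.add_comp _ _ _

theorem homPost_sub (f g : M →ₗ[R] N) : homPost D (f - g) = homPost D f - homPost D g :=
  LinearMap.ext fun _ => LinearMap.sub_comp _ _ _

theorem homPost_zero : homPost D (0 : M →ₗ[R] N) = 0 :=
  LinearMap.ext fun _ => LinearMap.zero_comp _

theorem homPost_zsmul (z : ℤ) (f : M →ₗ[R] N) : homPost D (z • f) = z • homPost D f :=
  LinearMap.ext fun _ => LinearMap.smul_comp _ _ _

variable {D}

theorem homPost_surjective [Module.Projective R D] {f : M →ₗ[R] N} (hf : Function.Surjective f) :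
    Function.Surjective (homPost D f) := fun g => Module.projective_lifting_property f g hf

theorem homPost_exact [Module.Projective R D] {f : M →ₗ[R] N} {g : N →ₗ[R] L}
    (h : Function.Exact f g) : Function.Exact (homPost D f) (homPost D g) := by
  intro x
  constructor
  · intro hx
    exact exists_lift_of_exact f g h x hx
  · rintro ⟨y, rfl⟩
    show g ∘ₗ (f ∘ₗ y) = 0
    rw [← LinearMap.comp_assoc, h.linearMap_comp_eq_zero, LinearMap.zero_comp]

variable {K : Type*} [Field K] [Module K M] [SMulCommClass R K M]

instance homEndOp_smulCommClass : SMulCommClass (Module.End R D)ᵐᵒᵖ K (D →ₗ[R] M) :=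
  ⟨fun _ _ _ => rfl⟩

instance homEndOp_isScalarTower [Algebra K R] [Module K D] [IsScalarTower K R D]
    [IsScalarTower K R M] :
    IsScalarTower K (Module.End R D)ᵐᵒᵖ (D →ₗ[R] M) :=
  ⟨fun c e f => LinearMap.ext fun x => by
    show f (c • e.unop x) = c • f (e.unop x)
    rw [LinearMap.map_smul_of_tower]⟩

end Basic

end HomFunctor

section GradedIso

variable {K : Type*} [Field K] {R : Type*} [Ring R] [Algebra K R]
  {D : Type*} [AddCommGroup D] [Module R D] [Module K D] [IsScalarTower K R D]
  {M : Type*} [AddCommGroup M] [Module R M] [Module K M] [IsScalarTower K R M]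
  {P : ℕ → Type*} [∀ l, AddCommGroup (P l)] [∀ l, Module R (P l)]
  [∀ l, Module K (P l)] [∀ l, IsScalarTower K R (P l)] [∀ l, SMulCommClass R K (P l)]
  {P' : ℕ → Type*} [∀ l, AddCommGroup (P' l)] [∀ l, Module (Module.End R D)ᵐᵒᵖ (P' l)]
  [∀ l, Module K (P' l)] [∀ l, IsScalarTower K (Module.End R D)ᵐᵒᵖ (P' l)]
  [∀ l, SMulCommClass (Module.End R D)ᵐᵒᵖ K (P' l)]

/-- If `Hom(D,−)` followed by restriction along a chain map `θ : P'• → Hom(D,P•)` over the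
identity is bijective on cohomology, then it induces an isomorphism of graded `Ext`-algebras. -/
theorem exists_gradedExtAlgIso [Module.Projective R D]
    (hP : ∀ l, Module.Projective R (P l)) (dP : ∀ l, P (l + 1) →ₗ[R] P l) (π : P 0 →ₗ[R] M)
    (hπ : Function.Surjective π) (hex0 : Function.Exact (dP 0) π)
    (hex : ∀ l, Function.Exact (dP (l + 1)) (dP l))
    (hP' : ∀ l, Module.Projective (Module.End R D)ᵐᵒᵖ (P' l))
    (dP' : ∀ l, P' (l + 1) →ₗ[(Module.End R D)ᵐᵒᵖ] P' l)
    (π' : P' 0 →ₗ[(Module.End R D)ᵐᵒᵖ] (D →ₗ[R] M))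
    (hπ' : Function.Surjective π') (hex0' : Function.Exact (dP' 0) π')
    (hex' : ∀ l, Function.Exact (dP' (l + 1)) (dP' l))
    (θ : ∀ l, P' l →ₗ[(Module.End R D)ᵐᵒᵖ] (D →ₗ[R] P l))
    (hθ : ∀ l, θ l ∘ₗ dP' l = homPost D (dP l) ∘ₗ θ (l + 1))
    (hπθ : homPost D π ∘ₗ θ 0 = π')
    (hinj : ∀ k (c : P k →ₗ[R] M), c ∘ₗ dP k = 0 → IsCoboundary dP' k (homPost D c ∘ₗ θ k) →
      IsCoboundary dP k c)
    (hsurj : ∀ k (c' : P' k →ₗ[(Module.End R D)ᵐᵒᵖ] (D →ₗ[R] M)), c' ∘ₗ dP' k = 0 →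
      ∃ c : P k →ₗ[R] M, c ∘ₗ dP k = 0 ∧ IsCoboundary dP' k (homPost D c ∘ₗ θ k - c')) :
    ∃ φ : ∀ k, extQ P dP K k ≃ₗ[K] extQ P' dP' K k, IsGradedExtAlgIso P dP P' dP' K φ := by
  let Φ : ∀ k, (P k →ₗ[R] M) →ₗ[K] (P' k →ₗ[(Module.End R D)ᵐᵒᵖ] (D →ₗ[R] M)) := fun k =>
    { toFun := fun c => homPost D c ∘ₗ θ k
      map_add' := fun c c' => by rw [homPost_add, LinearMap.add_comp]
      map_smul' := fun _ _ => rfl }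
  have hcoc : ∀ k (c : P k →ₗ[R] M), c ∘ₗ dP k = 0 → Φ k c ∘ₗ dP' k = 0 := fun k c hc => by
    show (homPost D c ∘ₗ θ k) ∘ₗ dP' k = 0
    rw [LinearMap.comp_assoc, hθ, ← LinearMap.comp_assoc, ← homPost_comp, hc, homPost_zero,
      LinearMap.zero_comp]
  have hcob : ∀ k (c : P k →ₗ[R] M), IsCoboundary dP k c → IsCoboundary dP' k (Φ k c) := by
    intro k c hc
    show IsCoboundary dP' k (homPost D c ∘ₗ θ k)
    refine IsCoboundary.comp_chain (dY := fun l => homPost D (dP l)) ?_ θ hθ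
    cases k with
    | zero =>
      have h₁ : c = 0 := hc
      rw [h₁]
      exact homPost_zero D
    | succ k =>
      obtain ⟨u, rfl⟩ := hc
      exact ⟨homPost D u, homPost_comp D _ _⟩
  have h₁ := fun k => exists_extQ_equiv K hP π hπ hex0 hex k
    (cocycles K dP' (D →ₗ[R] M) k) (coboundaries K dP' (D →ₗ[R] M) k) (Φ k) (hcoc k)
    (fun c hc => ⟨hinj k c hc, hcob k c⟩) (hsurj k)
  have h₂ := fun k => exists_extQ_equiv K hP' π' hπ' hex0' hex' k
    (cocycles K dP' (D →ₗ[R] M) k) (coboundaries K dP' (D →ₗ[R] M) k) LinearMap.id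
    (fun c hc => hc) (fun c hc => Iff.rfl)
    (fun z hz => ⟨z, hz, by rw [LinearMap.id_apply, sub_self]; exact Submodule.zero_mem _⟩)
  choose ψ hψ using h₁
  choose ψ' hψ' using h₂
  have hφ : ∀ k (x : ExtDeg R P k) (hx : IsChainMap P dP k x)
      (x' : ExtDeg (Module.End R D)ᵐᵒᵖ P' k) (hx' : IsChainMap P' dP' k x'),
      ((ψ k).trans (ψ' k).symm) (extMk P dP K k x hx) = extMk P' dP' K k x' hx' ↔
        IsCoboundary dP' k (homPost D (π ∘ₗ x 0 : P k →ₗ[R] M) ∘ₗ θ k -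
          (π' ∘ₗ x' 0 : P' k →ₗ[(Module.End R D)ᵐᵒᵖ] (D →ₗ[R] M))) := by
    intro k x hx x' hx'
    rw [LinearEquiv.trans_apply, LinearEquiv.symm_apply_eq, hψ, hψ', Submodule.Quotient.eq]
    rfl
  refine ⟨fun k => (ψ k).trans (ψ' k).symm, ?_, ?_⟩
  · intro hid hid'
    rw [hφ]
    show homPost D (π ∘ₗ LinearMap.id) ∘ₗ θ 0 - π' ∘ₗ LinearMap.id = 0
    rw [LinearMap.comp_id, LinearMap.comp_id, hπθ, sub_self]
  · intro j k x y hx hy hxy x' y' hx' hy' hxy' ex ey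
    rw [hφ] at ex ey ⊢
    have hzs : IsShiftMap dP' (fun l => homPost D (dP l)) k
        (fun m => homPost D (y m) ∘ₗ θ (k + m) - θ m ∘ₗ y' m) := by
      intro m
      have h₁ := hy m
      have h₂ := hy' m
      show (homPost D (y m) ∘ₗ θ (k + m) - θ m ∘ₗ y' m) ∘ₗ dP' (k + m) =
        ((-1 : ℤ) ^ k) • (homPost D (dP m) ∘ₗ
          (homPost D (y (m + 1)) ∘ₗ θ (k + m + 1) - θ (m + 1) ∘ₗ y' (m + 1)))
      rw [LinearMap.sub_comp, LinearMap.comp_assoc, LinearMap.comp_assoc, h₂, hθ,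
        ← LinearMap.comp_assoc, ← homPost_comp, h₁, homPost_zsmul, LinearMap.comp_smul,
        LinearMap.comp_sub, smul_sub, ← LinearMap.comp_assoc (y' (m + 1)), hθ,
        LinearMap.smul_comp]
      rfl
    have hz := hzs.isCoboundary_comp hP' (fun m => (hex' m).linearMap_comp_eq_zero)
      (homPost D π) (homPost_surjective hπ) (homPost_exact hex0) (fun m => homPost_exact (hex m))
      (by
        rw [LinearMap.comp_sub, ← LinearMap.comp_assoc, ← LinearMap.comp_assoc, hπθ]
        exact ey)
      (homPost D (π ∘ₗ x 0 : P j →ₗ[R] M))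
      (by
        rw [← homPost_comp]
        have := hx.augmentation_comp_d K hex0.linearMap_comp_eq_zero
        rw [show (π ∘ₗ x 0 : P j →ₗ[R] M) ∘ₗ dP j = 0 from this, homPost_zero])
    have hw := IsCoboundary.comp_shift hy' ex
    have hsum := (hz.add hw).comp_pcast (by omega : j + k = k + j)
    convert hsum using 1
    rw [LinearMap.comp_sub, LinearMap.sub_comp, LinearMap.comp_assoc _ (θ j), sub_add_sub_cancel,
      LinearMap.sub_comp]
    congr 1
    have hnat := pcast_naturality (P := P') (Q := fun l => D →ₗ[R] P l) (s := id) (t := id) θ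
      (by omega : j + k = k + j)
    have hpc : ∀ {a b : ℕ} (h : a = b), (pcast (fun l => D →ₗ[R] P l) h :
        (D →ₗ[R] P a) →ₗ[(Module.End R D)ᵐᵒᵖ] (D →ₗ[R] P b)) = homPost D (pcast P h) := by
      intro a b h
      subst h
      rfl
    rw [hpc] at hnat
    rw [LinearMap.comp_assoc, LinearMap.comp_assoc]
    erw [hnat]
    rfl

end GradedIso

section AddHull

variable {R : Type*} [Ring R]

/-- `Q` is a direct summand of a finite direct sum of copies of `D`. -/
def IsInAdd (R : Type*) [Ring R] (D : Type*) [AddCommGroup D] [Module R D]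
    (Q : Type*) [AddCommGroup Q] [Module R Q] : Prop :=
  ∃ (ι : Type) (_ : Fintype ι) (a : ι → D →ₗ[R] Q) (b : ι → Q →ₗ[R] D),
    ∑ s, a s ∘ₗ b s = LinearMap.id

variable {D : Type*} [AddCommGroup D] [Module R D] {Q : Type*} [AddCommGroup Q] [Module R Q]
  {N : Type*} [AddCommGroup N] [Module R N]

theorem IsInAdd.of_subsingleton [Subsingleton Q] : IsInAdd R D Q :=
  ⟨Empty, inferInstance, fun s => s.elim, fun s => s.elim, LinearMap.ext fun _ =>
    Subsingleton.elim _ _⟩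

theorem IsInAdd.prod (h : IsInAdd R D Q) : IsInAdd R D (Q × D) := by
  obtain ⟨ι, _, a, b, hab⟩ := h
  refine ⟨Option ι, inferInstance,
    fun s => s.elim (LinearMap.inr R Q D) (fun s => LinearMap.inl R Q D ∘ₗ a s),
    fun s => s.elim (LinearMap.snd R Q D) (fun s => b s ∘ₗ LinearMap.fst R Q D), ?_⟩
  have h' : ∀ x : Q, ∑ s, a s (b s x) = x := fun x => by
    simpa using LinearMap.congr_fun hab x
  rw [Fintype.sum_option]
  refine LinearMap.ext fun x => Prod.ext ?_ ?_
  · simp [LinearMap.sum_apply, Prod.fst_sum, h']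
  · simp [LinearMap.sum_apply, Prod.snd_sum]

theorem IsInAdd.projective [Module.Projective R D] (h : IsInAdd R D Q) :
    Module.Projective R Q := by
  obtain ⟨ι, _, a, b, hab⟩ := h
  refine Module.Projective.of_lifting_property'' fun f hf => ?_
  choose g hg using fun s => Module.projective_lifting_property f (a s) hf
  refine ⟨∑ s, g s ∘ₗ b s, LinearMap.ext fun x => ?_⟩
  simp only [LinearMap.comp_apply, LinearMap.sum_apply, map_sum]
  simpa [← hg, LinearMap.sum_apply] using LinearMap.congr_fun hab x

theorem IsInAdd.projective_hom (h : IsInAdd R D Q) :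
    Module.Projective (Module.End R D)ᵐᵒᵖ (D →ₗ[R] Q) := by
  obtain ⟨ι, _, a, b, hab⟩ := h
  refine IsInAdd.projective (D := (Module.End R D)ᵐᵒᵖ) ⟨ι, inferInstance,
    fun s => LinearMap.toSpanSingleton _ _ (a s),
    fun s => { toFun := fun g => MulOpposite.op (b s ∘ₗ g)
               map_add' := fun g g' => by rw [LinearMap.comp_add, MulOpposite.op_add]
               map_smul' := fun r g => rfl }, ?_⟩
  refine LinearMap.ext fun g => ?_
  rw [LinearMap.sum_apply]
  show ∑ s, a s ∘ₗ (b s ∘ₗ g) = g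
  refine LinearMap.ext fun x => ?_
  simpa [LinearMap.sum_apply] using LinearMap.congr_fun hab (g x)

theorem IsInAdd.homPost_injective (h : IsInAdd R D Q) {c : Q →ₗ[R] N} (hc : homPost D c = 0) :
    c = 0 := by
  obtain ⟨ι, _, a, b, hab⟩ := h
  have hca : ∀ s, c ∘ₗ a s = 0 := fun s => LinearMap.congr_fun hc (a s)
  rw [← LinearMap.comp_id c, ← hab]
  ext x
  simp only [LinearMap.comp_apply, LinearMap.sum_apply, map_sum, LinearMap.zero_apply]
  exact Finset.sum_eq_zero fun s _ => LinearMap.congr_fun (hca s) _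

theorem IsInAdd.homPost_surjective (h : IsInAdd R D Q)
    (T : (D →ₗ[R] Q) →ₗ[(Module.End R D)ᵐᵒᵖ] (D →ₗ[R] N)) :
    ∃ c : Q →ₗ[R] N, homPost D c = T := by
  obtain ⟨ι, _, a, b, hab⟩ := h
  refine ⟨∑ s, T (a s) ∘ₗ b s, LinearMap.ext fun g => ?_⟩
  have hT : ∀ s, T (a s ∘ₗ (b s ∘ₗ g)) = T (a s) ∘ₗ (b s ∘ₗ g) := fun s =>
    T.map_smul (MulOpposite.op (b s ∘ₗ g)) (a s)
  have hg : g = ∑ s, a s ∘ₗ (b s ∘ₗ g) := by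
    refine LinearMap.ext fun x => ?_
    simpa [LinearMap.sum_apply] using (LinearMap.congr_fun hab (g x)).symm
  conv_rhs => rw [hg, map_sum]
  refine LinearMap.ext fun x => ?_
  rw [homPost_apply, LinearMap.comp_apply, LinearMap.sum_apply, LinearMap.sum_apply]
  exact Finset.sum_congr rfl fun s _ => LinearMap.congr_fun (hT s).symm x

variable {K : Type*} [Field K] [Algebra K R] [Module K D] [IsScalarTower K R D]
  {M : Type*} [AddCommGroup M] [Module R M] [Module K M] [IsScalarTower K R M]
  {P : ℕ → Type*} [∀ l, AddCommGroup (P l)] [∀ l, Module R (P l)]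
  [∀ l, Module K (P l)] [∀ l, IsScalarTower K R (P l)] [∀ l, SMulCommClass R K (P l)]
  {P' : ℕ → Type*} [∀ l, AddCommGroup (P' l)] [∀ l, Module (Module.End R D)ᵐᵒᵖ (P' l)]
  [∀ l, Module K (P' l)] [∀ l, IsScalarTower K (Module.End R D)ᵐᵒᵖ (P' l)]
  [∀ l, SMulCommClass (Module.End R D)ᵐᵒᵖ K (P' l)]
  {Q : ℕ → Type*} [∀ l, AddCommGroup (Q l)] [∀ l, Module R (Q l)]

/-- If `M` has a resolution with terms in `add D`, `D` projective, then `Ext_R(M,M)` and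
`Ext_E(Hom(D,M),Hom(D,M))`, `E = End(D)ᵒᵖ`, are isomorphic graded algebras. -/
theorem exists_gradedExtAlgIso_of_add_resolution [Module.Projective R D]
    (hP : ∀ l, Module.Projective R (P l)) (dP : ∀ l, P (l + 1) →ₗ[R] P l) (π : P 0 →ₗ[R] M)
    (hπ : Function.Surjective π) (hex0 : Function.Exact (dP 0) π)
    (hex : ∀ l, Function.Exact (dP (l + 1)) (dP l))
    (hP' : ∀ l, Module.Projective (Module.End R D)ᵐᵒᵖ (P' l))
    (dP' : ∀ l, P' (l + 1) →ₗ[(Module.End R D)ᵐᵒᵖ] P' l)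
    (π' : P' 0 →ₗ[(Module.End R D)ᵐᵒᵖ] (D →ₗ[R] M))
    (hπ' : Function.Surjective π') (hex0' : Function.Exact (dP' 0) π')
    (hex' : ∀ l, Function.Exact (dP' (l + 1)) (dP' l))
    (hQ : ∀ l, IsInAdd R D (Q l)) (dQ : ∀ l, Q (l + 1) →ₗ[R] Q l) (πQ : Q 0 →ₗ[R] M)
    (hπQ : Function.Surjective πQ) (hQ0 : Function.Exact (dQ 0) πQ)
    (hQ1 : ∀ l, Function.Exact (dQ (l + 1)) (dQ l)) :
    ∃ φ : ∀ k, extQ P dP K k ≃ₗ[K] extQ P' dP' K k, IsGradedExtAlgIso P dP P' dP' K φ := by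
  have hQp : ∀ l, Module.Projective R (Q l) := fun l => (hQ l).projective
  have hFQp : ∀ l, Module.Projective (Module.End R D)ᵐᵒᵖ (D →ₗ[R] Q l) :=
    fun l => (hQ l).projective_hom
  obtain ⟨α, hπα, hα⟩ := exists_chain_lift hQp dQ (fun m => (hQ1 m).linearMap_comp_eq_zero) dP π
    hπ hex0 hex πQ hQ0.linearMap_comp_eq_zero
  obtain ⟨θ, hπθ, hθ⟩ := exists_chain_lift hP' dP' (fun m => (hex' m).linearMap_comp_eq_zero)
    (Y := fun l => D →ₗ[R] Q l) (fun l => homPost D (dQ l)) (homPost D πQ)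
    (homPost_surjective hπQ) (homPost_exact hQ0) (fun l => homPost_exact (hQ1 l)) π' hex0'.linearMap_comp_eq_zero
  have cmpR := fun k => comparison_of_resolutions (N' := M) (dX := dQ) (dY := dP) hQp hP πQ hπQ
    hQ0 hQ1 π hex0 hex α hα hπα k
  have cmpE := fun k => comparison_of_resolutions (N' := D →ₗ[R] M) (dX := dP')
    (Y := fun l => D →ₗ[R] Q l) (dY := fun l => homPost D (dQ l)) hP' hFQp π' hπ'
    hex0' hex' (homPost D πQ) (homPost_exact hQ0) (fun l => homPost_exact (hQ1 l)) θ hθ hπθ k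
  refine exists_gradedExtAlgIso hP dP π hπ hex0 hex hP' dP' π' hπ' hex0' hex'
    (fun l => homPost D (α l) ∘ₗ θ l) (fun l => ?_) ?_ (fun k c hc hb => ?_) (fun k c' hc' => ?_)
  · rw [LinearMap.comp_assoc, hθ, ← LinearMap.comp_assoc, ← homPost_comp, hα, homPost_comp,
      LinearMap.comp_assoc]
  · rw [← LinearMap.comp_assoc, ← homPost_comp, hπα, hπθ]
  · refine (cmpR k).1 c hc ?_
    rw [← LinearMap.comp_assoc, ← homPost_comp] at hb
    have h := (cmpE k).1 (homPost D (c ∘ₗ α k)) (by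
      rw [← homPost_comp, LinearMap.comp_assoc, hα, ← LinearMap.comp_assoc, hc,
        LinearMap.zero_comp, homPost_zero]) hb
    cases k with
    | zero => exact (hQ 0).homPost_injective h
    | succ k =>
      obtain ⟨u, hu⟩ := h
      obtain ⟨v, rfl⟩ := (hQ k).homPost_surjective u
      refine ⟨v, sub_eq_zero.1 ((hQ (k + 1)).homPost_injective ?_)⟩
      rw [homPost_sub, hu, homPost_comp, sub_self]
  · obtain ⟨T, hT, hTc⟩ := (cmpE k).2 c' hc'
    obtain ⟨b, rfl⟩ := (hQ k).homPost_surjective T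
    obtain ⟨c, hc, hcb⟩ := (cmpR k).2 b ((hQ (k + 1)).homPost_injective hT)
    refine ⟨c, hc, ?_⟩
    have h₁ : IsCoboundary (X := fun l => D →ₗ[R] Q l) (fun l => homPost D (dQ l)) k
        (homPost D (c ∘ₗ α k - b)) := by
      cases k with
      | zero =>
        have h₂ : c ∘ₗ α 0 - b = 0 := hcb
        rw [h₂, homPost_zero]
        rfl
      | succ k =>
        obtain ⟨u, hu⟩ := hcb
        exact ⟨homPost D u, by rw [hu, homPost_comp]⟩
    have h₂ := (h₁.comp_chain θ hθ).add hTc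
    rw [homPost_sub, LinearMap.sub_comp, sub_add_sub_cancel, homPost_comp,
      LinearMap.comp_assoc] at h₂
    exact h₂

end AddHull

section Filtered

/-- `M` has a finite filtration with all subquotients isomorphic to `D`. -/
inductive IsFilteredBy (R : Type u) [Ring R] (D : Type u) [AddCommGroup D] [Module R D] :
    ∀ (M : Type u) [AddCommGroup M] [Module R M], Prop
  | of_subsingleton (M : Type u) [AddCommGroup M] [Module R M] [Subsingleton M] :
      IsFilteredBy R D M
  | of_ker {M : Type u} [AddCommGroup M] [Module R M] (g : M →ₗ[R] D)
      (hg : Function.Surjective g) (h : IsFilteredBy R D (LinearMap.ker g)) :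
      IsFilteredBy R D M

variable {R : Type u} [Ring R] {D : Type u} [AddCommGroup D] [Module R D]

theorem IsFilteredBy.subsingleton_or_exists_ker {M : Type u} [AddCommGroup M] [Module R M]
    (h : IsFilteredBy R D M) : Subsingleton M ∨
      ∃ g : M →ₗ[R] D, Function.Surjective g ∧ IsFilteredBy R D (LinearMap.ker g) := by
  cases h with
  | of_subsingleton => exact Or.inl ‹_›
  | of_ker g hg h => exact Or.inr ⟨g, hg, h⟩

theorem IsFilteredBy.congr {M : Type u} [AddCommGroup M] [Module R M]
    (h : IsFilteredBy R D M) : ∀ {M' : Type u} [AddCommGroup M'] [Module R M']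
      (_ : M' ≃ₗ[R] M), IsFilteredBy R D M' := by
  induction h with
  | of_subsingleton M =>
    intro M' _ _ e
    have := e.toEquiv.subsingleton
    exact .of_subsingleton M'
  | of_ker g hg h ih =>
    intro M' _ _ e
    exact .of_ker (g ∘ₗ e.toLinearMap) (hg.comp e.surjective)
      (ih (e.ofSubmodule' (LinearMap.ker g)))

theorem IsFilteredBy.of_exact {V'' : Type u} [AddCommGroup V''] [Module R V'']
    (h'' : IsFilteredBy R D V'') : ∀ {V' V : Type u} [AddCommGroup V'] [Module R V']
      [AddCommGroup V] [Module R V] (f : V' →ₗ[R] V) (g : V →ₗ[R] V'')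
      (_ : Function.Injective f) (_ : Function.Surjective g) (_ : Function.Exact f g)
      (_ : IsFilteredBy R D V'), IsFilteredBy R D V := by
  induction h'' with
  | of_subsingleton M =>
    intro V' V _ _ _ _ f g hf hg hfg h'
    have hfs : Function.Surjective f := fun x => (hfg x).1 (Subsingleton.elim _ _)
    exact h'.congr (LinearEquiv.ofBijective f ⟨hf, hfs⟩).symm
  | of_ker g₀ hg₀ h ih =>
    intro V' V _ _ _ _ f g hf hg hfg h'
    have hfk : ∀ x, f x ∈ LinearMap.ker (g₀ ∘ₗ g) := fun x => by
      rw [LinearMap.mem_ker, LinearMap.comp_apply, hfg.apply_apply_eq_zero, map_zero]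
    refine .of_ker (g₀ ∘ₗ g) (hg₀.comp hg) (ih (f.codRestrict _ hfk)
      ((g ∘ₗ Submodule.subtype _).codRestrict (LinearMap.ker g₀) fun x => x.2) ?_ ?_ ?_ h')
    · exact fun x y hxy => hf (congrArg Subtype.val hxy)
    · rintro ⟨y, hy⟩
      obtain ⟨x, rfl⟩ := hg y
      exact ⟨⟨x, hy⟩, rfl⟩
    · rintro ⟨x, hx⟩
      constructor
      · intro h0
        obtain ⟨y, rfl⟩ := (hfg x).1 (congrArg Subtype.val h0)
        exact ⟨y, rfl⟩
      · rintro ⟨y, hy⟩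
        obtain rfl : f y = x := congrArg Subtype.val hy
        exact Subtype.ext (hfg.apply_apply_eq_zero y)

variable {Δ : Type u} [AddCommGroup Δ] [Module R Δ]

theorem IsFilteredBy.exists_add_cover [Module.Projective R Δ] (p₀ : Δ →ₗ[R] D)
    (hp₀ : Function.Surjective p₀) (hker : IsFilteredBy R D (LinearMap.ker p₀))
    {M : Type u} [AddCommGroup M] [Module R M] (h : IsFilteredBy R D M) :
    ∃ (Q : ModuleCat.{u} R) (_ : IsInAdd R Δ Q) (p : Q →ₗ[R] M) (_ : Function.Surjective p),
      IsFilteredBy R D (LinearMap.ker p) := by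
  induction h with
  | of_subsingleton M =>
    exact ⟨ModuleCat.of R PUnit, IsInAdd.of_subsingleton (Q := PUnit), 0,
      fun x => ⟨0, Subsingleton.elim _ _⟩,
      have : Subsingleton (ModuleCat.of R PUnit.{u+1}) := inferInstanceAs (Subsingleton PUnit)
      .of_subsingleton _⟩
  | of_ker g hg h ih =>
    obtain ⟨Q, hQ, q, hq, hqk⟩ := ih
    obtain ⟨l, hl⟩ := Module.projective_lifting_property g p₀ hg
    have hgl : ∀ x, g (l x) = p₀ x := LinearMap.congr_fun hl
    let p := LinearMap.coprod ((LinearMap.ker g).subtype ∘ₗ q) l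
    have hp : ∀ x, p x = (q x.1 : _) + l x.2 := fun x => LinearMap.coprod_apply _ _ _
    have hgp : ∀ x, g (p x) = p₀ x.2 := fun x => by
      rw [hp, map_add, (q x.1).2, zero_add, hgl]
    refine ⟨ModuleCat.of R (Q × Δ), hQ.prod, p, fun m => ?_, ?_⟩
    · obtain ⟨x, hx⟩ := hp₀ (g m)
      obtain ⟨a, ha⟩ := hq ⟨m - l x, by rw [LinearMap.mem_ker, map_sub, hgl, hx, sub_self]⟩
      exact ⟨(a, x), by rw [hp, ha]; simp⟩
    · refine hker.of_exact
        ((LinearMap.inl R Q Δ ∘ₗ Submodule.subtype _).codRestrict (LinearMap.ker p)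
          fun a => ?_)
        ((LinearMap.snd R Q Δ ∘ₗ (LinearMap.ker p).subtype).codRestrict (LinearMap.ker p₀)
          fun a => ?_) ?_ ?_ ?_ hqk
      · have ha : q a = 0 := a.2
        rw [LinearMap.mem_ker, hp]
        simp [ha]
      · have ha : p a = 0 := a.2
        rw [LinearMap.mem_ker]
        exact (hgp a).symm.trans (by rw [ha, map_zero])
      · exact fun x y hxy => Subtype.ext (congrArg (fun z => z.1.1) hxy)
      · rintro ⟨u, hu⟩
        obtain ⟨a, ha⟩ := hq ⟨-l u, by rw [LinearMap.mem_ker, map_neg, hgl, hu, neg_zero]⟩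
        exact ⟨⟨(a, u), by rw [LinearMap.mem_ker, hp, ha]; simp⟩, rfl⟩
      · rintro ⟨⟨a, b⟩, hab⟩
        constructor
        · intro h0
          obtain rfl : b = 0 := congrArg Subtype.val h0
          rw [LinearMap.mem_ker, hp] at hab
          exact ⟨⟨a, Subtype.ext (by simpa using hab)⟩, rfl⟩
        · rintro ⟨y, hy⟩
          exact Subtype.ext (congrArg (fun z => z.1.2) hy).symm

theorem IsFilteredBy.exists_add_resolution [Module.Projective R Δ] (p₀ : Δ →ₗ[R] D)
    (hp₀ : Function.Surjective p₀) (hker : IsFilteredBy R D (LinearMap.ker p₀))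
    {M : Type u} [AddCommGroup M] [Module R M] (h : IsFilteredBy R D M) :
    ∃ (Q : ℕ → ModuleCat.{u} R) (dQ : ∀ l, Q (l + 1) →ₗ[R] Q l) (πQ : Q 0 →ₗ[R] M),
      (∀ l, IsInAdd R Δ (Q l)) ∧ Function.Surjective πQ ∧ Function.Exact (dQ 0) πQ ∧
      ∀ l, Function.Exact (dQ (l + 1)) (dQ l) := by
  have key := fun X : {X : ModuleCat.{u} R // IsFilteredBy R D X} =>
    IsFilteredBy.exists_add_cover p₀ hp₀ hker X.2
  choose Q hQ p hp hpk using key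
  let Z : ℕ → {X : ModuleCat.{u} R // IsFilteredBy R D X} := fun m =>
    Nat.rec ⟨ModuleCat.of R M, h⟩ (fun _ X => ⟨ModuleCat.of R (LinearMap.ker (p X)), hpk X⟩) m
  have hexact : ∀ (X : {X : ModuleCat.{u} R // IsFilteredBy R D X}) {T : Type u}
      [AddCommGroup T] [Module R T] (q : T →ₗ[R] LinearMap.ker (p X)),
      Function.Surjective q → ∀ {V : Type u} [AddCommGroup V] [Module R V]
      (j : X.1 →ₗ[R] V), Function.Injective j →
      Function.Exact ((LinearMap.ker (p X)).subtype ∘ₗ q) (j ∘ₗ p X) := by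
    intro X T _ _ q hq V _ _ j hj y
    constructor
    · intro hy
      obtain ⟨t, ht⟩ := hq ⟨y, hj (by rw [map_zero]; exact hy)⟩
      exact ⟨t, congrArg Subtype.val ht⟩
    · rintro ⟨t, rfl⟩
      show j (p X (q t)) = 0
      rw [(q t).2, map_zero]
  exact ⟨fun m => Q (Z m), fun m => (LinearMap.ker (p (Z m))).subtype ∘ₗ p (Z (m + 1)), p (Z 0),
    fun m => hQ _, hp _, hexact (Z 0) (p (Z 1)) (hp _) LinearMap.id Function.injective_id,
    fun m => hexact (Z (m + 1)) (p (Z (m + 2))) (hp _) (LinearMap.ker (p (Z m))).subtype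
      Subtype.val_injective⟩

theorem IsFilteredBy.of_le_ker [IsNoetherian R Δ] (U : Submodule R Δ)
    (hU : ∀ g : Δ →ₗ[R] Δ ⧸ U, U ≤ LinearMap.ker g) (h : IsFilteredBy R (Δ ⧸ U) Δ) :
    IsFilteredBy R (Δ ⧸ U) U := by
  rcases h.subsingleton_or_exists_ker with hs | ⟨g, hg, hk⟩
  · exact .of_subsingleton _
  · have hsurj : Function.Surjective (U.liftQ g (hU g)) := fun y => by
      obtain ⟨x, rfl⟩ := hg y
      exact ⟨Submodule.Quotient.mk x, rfl⟩
    have hinj := IsNoetherian.injective_of_surjective_endomorphism _ hsurj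
    have hUk : U = LinearMap.ker g := le_antisymm (hU g) fun x hx => by
      rw [← Submodule.Quotient.mk_eq_zero]
      exact hinj (by rw [map_zero]; exact hx)
    exact hk.congr (LinearEquiv.ofEq _ _ hUk)

end Filtered

section RadicalAndIdempotents

variable {A : Type*} [Ring A]

theorem jacRad_eq_jacobson : jacRad A = Ring.jacobson A := by
  rw [← Ideal.jacobson_bot]
  simp [jacRad, Ideal.jacobson]

theorem mem_jacRad_iff {x : A} : x ∈ jacRad A ↔ ∀ y, ∃ z, z * (y * x + 1) = 1 := by
  rw [jacRad_eq_jacobson, ← Ideal.jacobson_bot, Ideal.mem_jacobson_iff]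
  refine forall_congr' fun y => exists_congr fun z => ?_
  rw [Ideal.mem_bot, sub_eq_zero, mul_add, mul_one, mul_assoc]

theorem mul_mem_jacRad_right {x : A} (hx : x ∈ jacRad A) (r : A) : x * r ∈ jacRad A := by
  rw [jacRad_eq_jacobson] at hx ⊢
  exact Ideal.mul_mem_right r _ hx

theorem map_mem_jacRad {A' : Type*} [Ring A'] {ρ : A →+* A'} (hρ : Function.Surjective ρ) {x : A}
    (hx : x ∈ jacRad A) : ρ x ∈ jacRad A' := by
  rw [mem_jacRad_iff] at hx ⊢
  intro y
  obtain ⟨y, rfl⟩ := hρ y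
  obtain ⟨z, hz⟩ := hx y
  exact ⟨ρ z, by rw [← map_mul, ← map_one ρ, ← map_add, ← map_mul, hz]⟩

theorem IsIdempotentElem.eq_zero_of_mem_jacRad {x : A} (hi : IsIdempotentElem x)
    (hx : x ∈ jacRad A) : x = 0 := by
  obtain ⟨z, hz⟩ := mem_jacRad_iff.1 hx (-1)
  calc x = z * (-1 * x + 1) * x := by rw [hz, one_mul]
    _ = z * (x - x * x) := by noncomm_ring
    _ = 0 := by rw [hi.eq, sub_self, mul_zero]

theorem mulRightLin_pow_apply (y x : A) (n : ℕ) : (mulRightLin A y ^ n) x = x * y ^ n := by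
  induction n generalizing x with
  | zero => simp
  | succ n ih =>
    rw [pow_succ, Module.End.mul_apply, ih, pow_succ', ← mul_assoc]
    rfl

/-- Fitting's lemma for `eAe`, `e` a primitive idempotent. -/
theorem IsPrimitiveIdem.isNilpotent_or_exists_mul_eq [IsNoetherianRing A] [IsArtinianRing A]
    {e : A} (he : IsPrimitiveIdem A e) {y : A} (hy : y * e = y) (hy' : e * y = y) :
    IsNilpotent y ∨ ∃ c, c * y = e := by
  obtain ⟨n, hn, hn1⟩ := ((LinearMap.eventually_isCompl_ker_pow_range_pow
    (mulRightLin A y)).and (Filter.eventually_ge_atTop 1)).exists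
  obtain ⟨m, rfl⟩ : ∃ m, n = m + 1 := ⟨n - 1, by omega⟩
  have hker : ∀ {z : A}, z ∈ LinearMap.ker (mulRightLin A y ^ (m + 1)) ↔ z * y ^ (m + 1) = 0 :=
    fun {z} => by rw [LinearMap.mem_ker, mulRightLin_pow_apply]
  have hran : ∀ {z : A}, z ∈ LinearMap.range (mulRightLin A y ^ (m + 1)) ↔
      ∃ w, w * y ^ (m + 1) = z :=
    fun {z} => by simp only [LinearMap.mem_range, mulRightLin_pow_apply]
  have hdis : ∀ {z : A}, z * y ^ (m + 1) = 0 → (∃ w, w * y ^ (m + 1) = z) → z = 0 :=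
    fun {z} h₁ h₂ => Submodule.disjoint_def.1 hn.disjoint z (hker.2 h₁) (hran.2 h₂)
  obtain ⟨u, hu, v, hv, huv⟩ := Submodule.mem_sup.1
    (hn.codisjoint.eq_top ▸ Submodule.mem_top : e ∈ _ ⊔ _)
  rw [hker] at hu
  rw [hran] at hv
  obtain ⟨w, rfl⟩ := hv
  set v := w * y ^ (m + 1) with hv
  have hve : v * e = v := by rw [hv, pow_succ, mul_assoc, mul_assoc, hy]
  have hue : u * e = u := by
    rw [eq_sub_of_add_eq huv, sub_mul, he.1.eq, hve]
  have hvu : v * u = 0 := hdis (by rw [mul_assoc, hu, mul_zero])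
    ⟨(1 - v) * w, by rw [mul_assoc, ← hv, eq_sub_of_add_eq huv, mul_sub, hve]; noncomm_ring⟩
  have hvv : v * v = v := by
    have h := hve
    rwa [← huv, mul_add, hvu, zero_add] at h
  have huv0 : u * v = 0 := hdis
    (by
      have h : u * v = u - u * u := by rw [eq_sub_of_add_eq' huv, mul_sub, hue]
      rw [h, sub_mul, mul_assoc, hu, mul_zero, sub_zero])
    ⟨u * w, by rw [hv, mul_assoc]⟩
  have huu : u * u = u := by
    have h := hue
    rwa [← huv, mul_add, huv0, add_zero] at h
  rcases he.2.2 u v huu hvv huv0 hvu huv.symm with h | h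
  · right
    refine ⟨w * y ^ m, ?_⟩
    rw [mul_assoc, ← pow_succ, ← hv, ← huv, h, zero_add]
  · left
    refine ⟨m + 1, ?_⟩
    rw [h, add_zero] at huv
    rwa [huv, pow_succ', ← mul_assoc, hy', ← pow_succ'] at hu

/-- `Ae` is local for `e` primitive. -/
theorem IsPrimitiveIdem.mem_jacRad_or_exists_mul_eq [IsNoetherianRing A] [IsArtinianRing A]
    {e : A} (he : IsPrimitiveIdem A e) {x : A} (hx : x * e = x) :
    x ∈ jacRad A ∨ ∃ c, c * x = e := by
  by_cases h : ∃ a c, c * (e * a * x) = e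
  · obtain ⟨a, c, hc⟩ := h
    exact Or.inr ⟨c * (e * a), by rw [mul_assoc, hc]⟩
  · push Not at h
    left
    refine mem_jacRad_iff.2 fun a => ?_
    have hnil : IsNilpotent (a * x) := by
      obtain ⟨k, hk⟩ := (he.isNilpotent_or_exists_mul_eq (y := e * a * x)
        (by rw [mul_assoc, hx]) (by rw [← mul_assoc, ← mul_assoc, he.1.eq])).resolve_right
        (fun ⟨c, hc⟩ => h a c hc)
      have hpow : ∀ k, (a * x) ^ (k + 1) = a * x * (e * a * x) ^ k := fun k => by
        induction k with
        | zero => simp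
        | succ k ih =>
          have hxx : a * x * (e * a * x) = a * x * (a * x) := by
            rw [mul_assoc e, ← mul_assoc (a * x), mul_assoc a x e, hx]
          rw [pow_succ', ih, pow_succ', ← mul_assoc, ← mul_assoc (a * x) (e * a * x), hxx]
      exact ⟨k + 1, by rw [hpow, hk, mul_zero]⟩
    obtain ⟨z, hz⟩ := hnil.isUnit_add_one.exists_left_inv
    exact ⟨z, hz⟩

theorem mem_leftIdeal {e x : A} (he : IsIdempotentElem e) : x ∈ leftIdeal A e ↔ x * e = x := by
  constructor
  · rintro ⟨y, rfl⟩
    show y * e * e = y * e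
    rw [mul_assoc, he.eq]
  · exact fun h => ⟨x, h⟩

/-- Right multiplication by `x = x * b`, as a homomorphism `Aa → Ab`. -/
def leftIdealMulRight (a : A) {b : A} (x : A) (hx : x * b = x) :
    ↥(leftIdeal A a) →ₗ[A] ↥(leftIdeal A b) :=
  (mulRightLin A x ∘ₗ (leftIdeal A a).subtype).codRestrict _ fun z =>
    ⟨z * x, by show (z : A) * x * b = z * x; rw [mul_assoc, hx]⟩

theorem mem_jacRad_of_not_iso [IsNoetherianRing A] [IsArtinianRing A]
    {e f : A} (he : IsPrimitiveIdem A e) (hf : IsPrimitiveIdem A f)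
    (hef : ¬ Nonempty (↥(leftIdeal A e) ≃ₗ[A] ↥(leftIdeal A f))) {x : A}
    (hx : x * f = x) (hx' : e * x = x) : x ∈ jacRad A := by
  refine (hf.mem_jacRad_or_exists_mul_eq hx).resolve_right fun ⟨c₀, hc₀⟩ => hef ?_
  obtain ⟨c, hc, hce⟩ : ∃ c, c * x = f ∧ c * e = c :=
    ⟨c₀ * e, by rw [mul_assoc, hx', hc₀], by rw [mul_assoc, he.1.eq]⟩
  have hxc : IsIdempotentElem (x * c) := by
    show x * c * (x * c) = x * c
    rw [mul_assoc, ← mul_assoc c, hc, ← mul_assoc, hx]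
  have hexc : e * (x * c) = x * c := by rw [← mul_assoc, hx']
  have hxce : x * c * e = x * c := by rw [mul_assoc, hce]
  have hxce' : x * c = e := by
    rcases he.2.2 (x * c) (e - x * c) hxc
      (by
        show (e - x * c) * (e - x * c) = _
        rw [mul_sub, sub_mul, sub_mul, he.1.eq, hexc, hxce, hxc.eq]
        abel)
      (by rw [mul_sub, hxce, hxc.eq, sub_self]) (by rw [sub_mul, hexc, hxc.eq, sub_self])
      (by abel) with h | h
    · refine absurd ?_ hf.2.1
      rw [← hf.1.eq, ← hc, mul_assoc, ← mul_assoc x, h, zero_mul, mul_zero]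
    · exact (sub_eq_zero.1 h).symm
  refine ⟨LinearEquiv.ofLinearMap (leftIdealMulRight e x hx) (leftIdealMulRight f c hce) ?_ ?_⟩
  · refine LinearMap.ext fun z => Subtype.ext ?_
    show (z : A) * c * x = z
    rw [mul_assoc, hc, (mem_leftIdeal hf.1).1 z.2]
  · refine LinearMap.ext fun z => Subtype.ext ?_
    show (z : A) * x * c = z
    rw [mul_assoc, hxce', (mem_leftIdeal he.1).1 z.2]

theorem projective_leftIdeal {e : A} (he : IsIdempotentElem e) :
    Module.Projective A (leftIdeal A e) := by
  refine Module.Projective.of_split (leftIdeal A e).subtype (mulRightLin A e).rangeRestrict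
    (LinearMap.ext fun z => Subtype.ext ?_)
  exact (mem_leftIdeal he).1 z.2

theorem IsRadHom.mem_jacRad {e : A} {M : Type*} [AddCommGroup M] [Module A M]
    {φ : M →ₗ[A] leftIdeal A e} (hφ : IsRadHom A φ) (m : M) : (φ m : A) ∈ jacRad A := by
  have h : radM A (leftIdeal A e) ≤ Submodule.comap (leftIdeal A e).subtype (jacRad A) := by
    refine Submodule.span_le.2 ?_
    rintro _ ⟨r, hr, z, rfl⟩
    exact mul_mem_jacRad_right hr z
  exact h (hφ ⟨m, rfl⟩)

theorem IsRadHom.comp_left {L M N : Type*} [AddCommGroup L] [Module A L] [AddCommGroup M]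
    [Module A M] [AddCommGroup N] [Module A N] {φ : L →ₗ[A] M} (hφ : IsRadHom A φ)
    (g : M →ₗ[A] N) : IsRadHom A (g ∘ₗ φ) := by
  have h : radM A M ≤ Submodule.comap g (radM A N) := by
    refine Submodule.span_le.2 ?_
    rintro _ ⟨r, hr, z, rfl⟩
    rw [SetLike.mem_coe, Submodule.mem_comap, map_smul]
    exact Submodule.subset_span ⟨r, hr, g z, rfl⟩
  rintro _ ⟨x, rfl⟩
  exact h (hφ ⟨x, rfl⟩)

theorem isRadHom_leftIdealMulRight (a : A) {b : A} (hb : IsIdempotentElem b) {x : A}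
    (hx : x * b = x) (hxr : x ∈ jacRad A) : IsRadHom A (leftIdealMulRight a x hx) := by
  rintro _ ⟨z, rfl⟩
  refine Submodule.subset_span ⟨z * x, Ideal.mul_mem_left _ _ hxr,
    ⟨b, (mem_leftIdeal hb).2 hb.eq⟩, Subtype.ext ?_⟩
  show (z : A) * x = z * x * b
  rw [mul_assoc, hx]

theorem apply_eq_mul_apply_idempotent {a b : A} (ha : IsIdempotentElem a)
    (φ : leftIdeal A a →ₗ[A] leftIdeal A b) (z : leftIdeal A a) :
    φ z = (z : A) • φ ⟨a, (mem_leftIdeal ha).2 ha.eq⟩ := by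
  rw [← map_smul]
  exact congrArg φ (Subtype.ext ((mem_leftIdeal ha).1 z.2).symm)

theorem idempotent_mul_apply {a b : A} (ha : IsIdempotentElem a)
    (φ : leftIdeal A a →ₗ[A] leftIdeal A b) :
    a * (φ ⟨a, (mem_leftIdeal ha).2 ha.eq⟩ : A) = φ ⟨a, (mem_leftIdeal ha).2 ha.eq⟩ :=
  congrArg Subtype.val (apply_eq_mul_apply_idempotent ha φ ⟨a, (mem_leftIdeal ha).2 ha.eq⟩).symm

variable {n : ℕ} {e : Fin n → A}

theorem apply_mem_properU {i j : Fin n} (hij : i ≤ j)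
    {φ : leftIdeal A (e j) →ₗ[A] leftIdeal A (e i)} (hφ : IsRadHom A φ) (z : leftIdeal A (e j)) :
    φ z ∈ properU A e i := by
  have h : LinearMap.range φ ≤ properU A e i :=
    le_iSup₂_of_le j hij (le_iSup₂_of_le φ hφ le_rfl)
  exact h ⟨z, rfl⟩

theorem properU_le {i : Fin n} {S : Submodule A (leftIdeal A (e i))}
    (h : ∀ j, i ≤ j → ∀ φ : leftIdeal A (e j) →ₗ[A] leftIdeal A (e i), IsRadHom A φ →
      ∀ z, φ z ∈ S) : properU A e i ≤ S := by
  refine iSup₂_le fun j hij => iSup₂_le fun φ hφ => ?_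
  rintro _ ⟨z, rfl⟩
  exact h j hij φ hφ z

theorem mem_properU_of_mem_jacRad (hid : ∀ j, IsIdempotentElem (e j)) {i l : Fin n} (hil : i ≤ l)
    (x : leftIdeal A (e i)) (hx : e l * x = x) (hxr : (x : A) ∈ jacRad A) :
    x ∈ properU A e i := by
  have hxi := (mem_leftIdeal (hid i)).1 x.2
  have h := apply_mem_properU hil (isRadHom_leftIdealMulRight (e l) (hid i) hxi hxr)
    ⟨e l, (mem_leftIdeal (hid l)).2 (hid l).eq⟩
  have hx' : leftIdealMulRight (e l) (x : A) hxi ⟨e l, (mem_leftIdeal (hid l)).2 (hid l).eq⟩ = x :=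
    Subtype.ext hx
  rwa [hx'] at h

theorem properU_le_ker (hid : ∀ j, IsIdempotentElem (e j)) {i : Fin n}
    (g : leftIdeal A (e i) →ₗ[A] PStd A e i) : properU A e i ≤ LinearMap.ker g := by
  have := projective_leftIdeal (hid i)
  obtain ⟨g', rfl⟩ := Module.projective_lifting_property (properU A e i).mkQ g
    (Submodule.mkQ_surjective _)
  refine properU_le fun j hij φ hφ z => ?_
  rw [LinearMap.mem_ker, LinearMap.comp_apply, Submodule.mkQ_apply, Submodule.Quotient.mk_eq_zero]
  exact apply_mem_properU hij (hφ.comp_left g') z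

theorem mul_sumLater (horth : ∀ i j, i ≠ j → e i * e j = 0) (hid : ∀ j, IsIdempotentElem (e j))
    {i l : Fin n} (hil : i < l) : e l * sumLater A e i = e l := by
  rw [sumLater, Finset.mul_sum, Finset.sum_eq_single_of_mem l (by simpa using hil)
    (fun j _ hj => horth l j hj.symm), (hid l).eq]

theorem sumLater_mul_self (horth : ∀ i j, i ≠ j → e i * e j = 0)
    (hid : ∀ j, IsIdempotentElem (e j)) (i : Fin n) :
    sumLater A e i * sumLater A e i = sumLater A e i := by
  conv_lhs => enter [1]; rw [sumLater]
  rw [Finset.sum_mul]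
  exact Finset.sum_congr rfl fun l hl => mul_sumLater horth hid (Finset.mem_filter.1 hl).2

end RadicalAndIdempotents

section TraceQuotient

/-- The trace of `Aε` in `N`, i.e. `AεN`. -/
def traceSub {A : Type*} [Ring A] (ε : A) (N : Type*) [AddCommGroup N] [Module A N] :
    Submodule A N :=
  Submodule.span A {x | ∃ m : N, x = ε • m}

variable {A : Type*} [Ring A] {A' : Type*} [Ring A'] {ρ : A →+* A'}

theorem smul_mem_traceSub {ε : A} {N : Type*} [AddCommGroup N] [Module A N] (m : N) :
    ε • m ∈ traceSub ε N := Submodule.subset_span ⟨m, rfl⟩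

theorem traceSub_le {ε : A} {N : Type*} [AddCommGroup N] [Module A N] {S : Submodule A N}
    (h : ∀ m : N, ε • m ∈ S) : traceSub ε N ≤ S :=
  Submodule.span_le.2 (by rintro _ ⟨m, rfl⟩; exact h m)

theorem exists_factor_semilinear {N : Type*} [AddCommGroup N] [Module A N] {M V : Type*}
    [AddCommGroup M] [Module A' M] [AddCommGroup V] [Module A' V] (hρ : Function.Surjective ρ)
    (q : N →ₛₗ[ρ] M) (hq : Function.Surjective q) (h : N →ₛₗ[ρ] V)
    (hker : ∀ x, q x = 0 → h x = 0) : ∃ g : M →ₗ[A'] V, ∀ x, g (q x) = h x := by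
  have key : ∀ x y, q x = q y → h x = h y := fun x y hxy => by
    rw [← sub_eq_zero, ← map_sub]
    exact hker _ (by rw [map_sub, hxy, sub_self])
  choose s hs using hq
  have hsq : ∀ x, h (s (q x)) = h x := fun x => key _ _ (hs _)
  refine ⟨{ toFun := fun m => h (s m), map_add' := fun a b => ?_, map_smul' := fun r a => ?_ },
    hsq⟩
  · rw [← map_add]
    exact key _ _ (by rw [hs, map_add, hs, hs])
  · obtain ⟨r, rfl⟩ := hρ r
    rw [RingHom.id_apply, ← h.map_smulₛₗ]
    exact key _ _ (by rw [hs, q.map_smulₛₗ, hs])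

/-- The semilinear map `Aa → A'ρ(a)` induced by `ρ`. -/
def leftIdealMap (ρ : A →+* A') (a : A) : leftIdeal A a →ₛₗ[ρ] leftIdeal A' (ρ a) where
  toFun z := ⟨ρ z, by
    obtain ⟨y, hy⟩ := z.2
    exact ⟨ρ y, by rw [← hy]; exact (map_mul ρ y a).symm⟩⟩
  map_add' x y := Subtype.ext (map_add ρ _ _)
  map_smul' r x := Subtype.ext (map_mul ρ _ _)

theorem coe_leftIdealMap (a : A) (z : leftIdeal A a) : (leftIdealMap ρ a z : A') = ρ z := rfl

theorem leftIdealMap_surjective (hρ : Function.Surjective ρ) (a : A) :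
    Function.Surjective (leftIdealMap ρ a) := by
  rintro ⟨_, y, rfl⟩
  obtain ⟨y, rfl⟩ := hρ y
  exact ⟨⟨y * a, y, rfl⟩, Subtype.ext (map_mul ρ _ _)⟩

variable {n : ℕ} {e : Fin n → A}

theorem leftIdealMap_eq_zero_iff (hid : ∀ j, IsIdempotentElem (e j)) {i : Fin n}
    (hρker : ∀ a : A, ρ a = 0 ↔
      a ∈ Submodule.span A {x | ∃ u v : A, x = u * (sumLater A e i) * v})
    (z : leftIdeal A (e i)) :
    leftIdealMap ρ (e i) z = 0 ↔ z ∈ traceSub (sumLater A e i) (leftIdeal A (e i)) := by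
  constructor
  · intro hz
    have hz0 : ρ z = 0 := congrArg Subtype.val hz
    have hle : Submodule.span A {x | ∃ u v : A, x = u * (sumLater A e i) * v} ≤
        Submodule.comap (mulRightLin A (e i)).rangeRestrict
          (traceSub (sumLater A e i) (leftIdeal A (e i))) := by
      refine Submodule.span_le.2 ?_
      rintro _ ⟨u, v, rfl⟩
      have h := Submodule.smul_mem _ u (smul_mem_traceSub (ε := sumLater A e i)
        ((mulRightLin A (e i)).rangeRestrict v))
      rwa [← map_smul, ← map_smul, smul_eq_mul, smul_eq_mul, ← mul_assoc] at h
    have h : (mulRightLin A (e i)).rangeRestrict (z : A) ∈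
        traceSub (sumLater A e i) (leftIdeal A (e i)) := hle ((hρker z).1 hz0)
    have hze : (mulRightLin A (e i)).rangeRestrict (z : A) = z :=
      Subtype.ext ((mem_leftIdeal (hid i)).1 z.2)
    rwa [hze] at h
  · have hε : ρ (sumLater A e i) = 0 := (hρker _).2 (Submodule.subset_span ⟨1, 1, by simp⟩)
    have hle : traceSub (sumLater A e i) (leftIdeal A (e i)) ≤
        LinearMap.ker (leftIdealMap ρ (e i)) := traceSub_le fun m => by
      rw [LinearMap.mem_ker, LinearMap.map_smulₛₗ, hε, zero_smul]
    exact fun hz => hle hz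

theorem map_idempotent_eq_zero (hid : ∀ j, IsIdempotentElem (e j))
    (horth : ∀ i j, i ≠ j → e i * e j = 0) {i l : Fin n}
    (hε : ρ (sumLater A e i) = 0) (hil : i < l) : ρ (e l) = 0 := by
  rw [← mul_sumLater horth hid hil, map_mul, hε, mul_zero]

section Basic

variable [IsNoetherianRing A] [IsArtinianRing A]

theorem idempotent_smul_mem_properU (hidem : ∀ j, IsPrimitiveIdem A (e j))
    (hbasic : ∀ i j, i ≠ j → ¬ Nonempty (↥(leftIdeal A (e i)) ≃ₗ[A] ↥(leftIdeal A (e j))))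
    {i l : Fin n} (hil : i < l) (y : leftIdeal A (e i)) : e l • y ∈ properU A e i := by
  have hl : e l * (e l * (y : A)) = e l * y := by rw [← mul_assoc, (hidem l).1.eq]
  refine mem_properU_of_mem_jacRad (fun j => (hidem j).1) hil.le _ hl
    (mem_jacRad_of_not_iso (hidem l) (hidem i) (hbasic l i hil.ne') ?_ hl)
  exact (mem_leftIdeal (hidem i).1).1 (e l • y).2

theorem traceSub_le_properU (hidem : ∀ j, IsPrimitiveIdem A (e j))
    (hbasic : ∀ i j, i ≠ j → ¬ Nonempty (↥(leftIdeal A (e i)) ≃ₗ[A] ↥(leftIdeal A (e j))))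
    (i : Fin n) : traceSub (sumLater A e i) (leftIdeal A (e i)) ≤ properU A e i := by
  refine traceSub_le fun m => ?_
  rw [sumLater, Finset.sum_smul]
  exact Submodule.sum_mem _ fun l hl =>
    idempotent_smul_mem_properU hidem hbasic (Finset.mem_filter.1 hl).2 m

theorem leftIdealMap_mem_properU_iff (hidem : ∀ j, IsPrimitiveIdem A (e j))
    (horth : ∀ i j, i ≠ j → e i * e j = 0)
    (hbasic : ∀ i j, i ≠ j → ¬ Nonempty (↥(leftIdeal A (e i)) ≃ₗ[A] ↥(leftIdeal A (e j))))
    (hρ : Function.Surjective ρ) {i : Fin n}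
    (hρker : ∀ a : A, ρ a = 0 ↔
      a ∈ Submodule.span A {x | ∃ u v : A, x = u * (sumLater A e i) * v})
    (z : leftIdeal A (e i)) :
    leftIdealMap ρ (e i) z ∈ properU A' (fun j => ρ (e j)) i ↔ z ∈ properU A e i := by
  have hid : ∀ j, IsIdempotentElem (e j) := fun j => (hidem j).1
  have hid' : ∀ j, IsIdempotentElem (ρ (e j)) := fun j => (hid j).map ρ
  have hε : ρ (sumLater A e i) = 0 := (hρker _).2 (Submodule.subset_span ⟨1, 1, by simp⟩)
  have : RingHomSurjective ρ := ⟨hρ⟩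
  constructor
  · intro hz
    have hle : properU A' (fun j => ρ (e j)) i ≤
        Submodule.map (leftIdealMap ρ (e i)) (properU A e i) := by
      refine properU_le fun j hij φ hφ w => ?_
      rw [apply_eq_mul_apply_idempotent (hid' j) φ w]
      refine Submodule.smul_mem _ _ ?_
      have hx := idempotent_mul_apply (hid' j) φ
      have hxr := hφ.mem_jacRad ⟨ρ (e j), (mem_leftIdeal (hid' j)).2 (hid' j).eq⟩
      generalize φ ⟨ρ (e j), _⟩ = x' at hx hxr ⊢
      rcases hij.lt_or_eq with hlt | rfl
      · have hx0 : x' = 0 := Subtype.ext (by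
          rw [← hx, map_idempotent_eq_zero hid horth hε hlt, zero_mul]; rfl)
        rw [hx0]
        exact Submodule.zero_mem _
      · obtain ⟨x₀, rfl⟩ := leftIdealMap_surjective hρ _ x'
        rw [coe_leftIdealMap] at hx hxr
        have hxx : leftIdealMap ρ (e i) (e i • x₀) = leftIdealMap ρ (e i) x₀ :=
          Subtype.ext ((map_mul ρ _ _).trans hx)
        rw [← hxx]
        refine Submodule.mem_map_of_mem ?_
        have hi : e i * (e i * (x₀ : A)) = e i * x₀ := by rw [← mul_assoc, (hid i).eq]
        rcases (hidem i).mem_jacRad_or_exists_mul_eq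
          ((mem_leftIdeal (hid i)).1 (e i • x₀).2) with hr | ⟨c, hc⟩
        · exact mem_properU_of_mem_jacRad hid le_rfl _ hi hr
        · have hei : ρ (e i) = 0 := (hid' i).eq_zero_of_mem_jacRad (by
            rw [← hc, map_mul]
            refine Ideal.mul_mem_left _ _ ?_
            show ρ (e i * x₀) ∈ _
            rwa [map_mul, hx])
          refine traceSub_le_properU hidem hbasic i
            ((leftIdealMap_eq_zero_iff hid hρker _).1 (Subtype.ext ?_))
          show ρ (e i * x₀) = 0
          rw [map_mul, hei, zero_mul]
    obtain ⟨y, hy, hyz⟩ := hle hz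
    rw [← sub_add_cancel z y]
    refine Submodule.add_mem _ (traceSub_le_properU hidem hbasic i
      ((leftIdealMap_eq_zero_iff hid hρker _).1 ?_)) hy
    rw [map_sub, hyz, sub_self]
  · have hle : properU A e i ≤
        Submodule.comap (leftIdealMap ρ (e i)) (properU A' (fun j => ρ (e j)) i) := by
      refine properU_le fun j hij φ hφ w => ?_
      rw [apply_eq_mul_apply_idempotent (hid j) φ w]
      refine Submodule.smul_mem _ _ ?_
      refine mem_properU_of_mem_jacRad hid' hij _ ?_ (map_mem_jacRad hρ (hφ.mem_jacRad _))
      rw [coe_leftIdealMap, ← map_mul, idempotent_mul_apply (hid j) φ]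
    exact fun hz => hle hz

end Basic

section Filtration

variable {A A' : Type u} [Ring A] [Ring A'] {ρ : A →+* A'} {n : ℕ} {e : Fin n → A}
  {N N₁ : Type u} [AddCommGroup N] [Module A N] [AddCommGroup N₁] [Module A N₁]

/-- If `0 → N₁ → N → Δ̄(j) → 0` is exact with `j > i`, then `N₁/AεN₁ ≅ N/AεN`. -/
theorem isFilteredBy_of_exact_later (hid : ∀ j, IsIdempotentElem (e j))
    (horth : ∀ i j, i ≠ j → e i * e j = 0) {i j : Fin n} (hij : i < j)
    {D : Type u} [AddCommGroup D] [Module A' D]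
    (f : N₁ →ₗ[A] N) (hf : Function.Injective f) (g : N →ₗ[A] PStd A e j)
    (hg : Function.Surjective g) (hfg : Function.Exact f g)
    (ih : ∀ (M : Type u) [AddCommGroup M] [Module A' M] (q : N₁ →ₛₗ[ρ] M),
      Function.Surjective q → (∀ x, q x = 0 ↔ x ∈ traceSub (sumLater A e i) N₁) →
      IsFilteredBy A' D M)
    {M : Type u} [AddCommGroup M] [Module A' M] (q : N →ₛₗ[ρ] M) (hq : Function.Surjective q)
    (hqk : ∀ x, q x = 0 ↔ x ∈ traceSub (sumLater A e i) N) : IsFilteredBy A' D M := by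
  let ε := sumLater A e i
  let gen : leftIdeal A (e j) := ⟨e j, (mem_leftIdeal (hid j)).2 (hid j).eq⟩
  have hgen : ∀ z : leftIdeal A (e j), (z : A) • gen = z := fun z =>
    Subtype.ext ((mem_leftIdeal (hid j)).1 z.2)
  have hleε : ∀ l, i < l → e l * ε = e l := fun l hl => mul_sumLater horth hid hl
  obtain ⟨n₁, hn₁⟩ := hg ((properU A e j).mkQ gen)
  obtain ⟨n₀, hn₀, hgn₀⟩ : ∃ n₀, e j • n₀ = n₀ ∧ g n₀ = (properU A e j).mkQ gen := by
    refine ⟨e j • n₁, by rw [smul_smul, (hid j).eq], ?_⟩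
    rw [map_smul, hn₁, ← map_smul]
    exact congrArg _ (hgen gen)
  have hgs : ∀ z : leftIdeal A (e j), g ((z : A) • n₀) = (properU A e j).mkQ z := fun z => by
    rw [map_smul, hgn₀, ← map_smul, hgen]
  have hn₀t : n₀ ∈ traceSub ε N := by
    rw [← hn₀, ← hleε j hij, mul_smul]
    exact Submodule.smul_mem _ _ (smul_mem_traceSub _)
  have hdec : ∀ x : N, ∃ (y : N₁) (z : leftIdeal A (e j)), x = f y + (z : A) • n₀ := fun x => by
    obtain ⟨z, hz⟩ := Submodule.mkQ_surjective _ (g x)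
    obtain ⟨y, hy⟩ := (hfg (x - (z : A) • n₀)).1 (by rw [map_sub, hgs, hz, sub_self])
    exact ⟨y, z, by rw [hy, sub_add_cancel]⟩
  have hU : properU A e j ≤ Submodule.comap
      (LinearMap.toSpanSingleton A N n₀ ∘ₗ (leftIdeal A (e j)).subtype)
      (Submodule.map f (traceSub ε N₁)) := by
    refine properU_le fun l hjl φ hφ w => ?_
    rw [apply_eq_mul_apply_idempotent (hid l) φ w]
    refine Submodule.smul_mem _ _ ?_
    have hx := idempotent_mul_apply (hid l) φ
    have hxU := apply_mem_properU hjl hφ ⟨e l, (mem_leftIdeal (hid l)).2 (hid l).eq⟩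
    generalize φ ⟨e l, _⟩ = x at hx hxU ⊢
    obtain ⟨y, hy⟩ := (hfg ((x : A) • n₀)).1 (by
      rw [hgs, Submodule.mkQ_apply, Submodule.Quotient.mk_eq_zero]
      exact hxU)
    refine ⟨e l • ε • y, Submodule.smul_mem _ _ (smul_mem_traceSub _), ?_⟩
    rw [smul_smul, hleε l (hij.trans_le hjl), map_smul, hy, smul_smul, hx]
    rfl
  have htr : traceSub ε N ≤ Submodule.map f (traceSub ε N₁) ⊔ Submodule.span A {n₀} :=
    traceSub_le fun m => by
      obtain ⟨y, z, rfl⟩ := hdec m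
      rw [smul_add, ← map_smul]
      exact Submodule.add_mem_sup ⟨_, smul_mem_traceSub y, rfl⟩
        (Submodule.smul_mem _ _ (Submodule.smul_mem _ _ (Submodule.mem_span_singleton_self _)))
  refine ih M (q.comp f) ?_ fun y => ?_
  · intro m
    obtain ⟨x, rfl⟩ := hq m
    obtain ⟨y, z, rfl⟩ := hdec x
    refine ⟨y, ?_⟩
    rw [map_add, (hqk ((z : A) • n₀)).2 (Submodule.smul_mem _ _ hn₀t), add_zero]
    rfl
  · rw [LinearMap.comp_apply, hqk]
    constructor
    · intro hy
      obtain ⟨_, ⟨t, ht, rfl⟩, s, hs, hts⟩ := Submodule.mem_sup.1 (htr hy)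
      obtain ⟨a, rfl⟩ := Submodule.mem_span_singleton.1 hs
      rw [← hn₀, smul_smul] at hts
      have ha : (⟨a * e j, a, rfl⟩ : leftIdeal A (e j)) ∈ properU A e j := by
        rw [← Submodule.Quotient.mk_eq_zero, ← Submodule.mkQ_apply, ← hgs, ← map_zero g]
        have h0 := congrArg g hts
        rw [map_add, hfg.apply_apply_eq_zero, hfg.apply_apply_eq_zero, zero_add] at h0
        rw [map_zero]
        exact h0
      obtain ⟨t', ht', htt⟩ := hU ha
      have hyt : y = t + t' := hf (by rw [map_add, htt]; exact hts.symm)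
      rw [hyt]
      exact Submodule.add_mem _ ht ht'
    · intro hy
      have hle : traceSub ε N₁ ≤ Submodule.comap f (traceSub ε N) := traceSub_le fun m => by
        rw [Submodule.mem_comap, map_smul]
        exact smul_mem_traceSub _
      exact hle hy

/-- If `0 → N₁ → N → Δ̄(i) → 0` is exact, then so is `0 → N₁/AεN₁ → N/AεN → Δ̄(i) → 0`. -/
theorem isFilteredBy_of_exact_self {ε : A} {V : Type u} [AddCommGroup V] [Module A V]
    {D : Type u} [AddCommGroup D] [Module A' D] (hρ : Function.Surjective ρ)
    (hε : ε * ε = ε) (hV : ∀ v : V, ε • v = 0) (τ : V →ₛₗ[ρ] D) (hτ : Function.Bijective τ)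
    (f : N₁ →ₗ[A] N) (hf : Function.Injective f) (g : N →ₗ[A] V)
    (hg : Function.Surjective g) (hfg : Function.Exact f g)
    (ih : ∀ (M : Type u) [AddCommGroup M] [Module A' M] (q : N₁ →ₛₗ[ρ] M),
      Function.Surjective q → (∀ x, q x = 0 ↔ x ∈ traceSub ε N₁) → IsFilteredBy A' D M)
    {M : Type u} [AddCommGroup M] [Module A' M] (q : N →ₛₗ[ρ] M) (hq : Function.Surjective q)
    (hqk : ∀ x, q x = 0 ↔ x ∈ traceSub ε N) : IsFilteredBy A' D M := by
  have hle : traceSub ε N ≤ Submodule.map f (traceSub ε N₁) := traceSub_le fun m => by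
    obtain ⟨y, hy⟩ := (hfg (ε • m)).1 (by rw [map_smul, hV])
    exact ⟨ε • y, smul_mem_traceSub y, by rw [map_smul, hy, smul_smul, hε]⟩
  have hle' : traceSub ε N₁ ≤ Submodule.comap f (traceSub ε N) := traceSub_le fun m => by
    rw [Submodule.mem_comap, map_smul]
    exact smul_mem_traceSub _
  obtain ⟨g', hg'⟩ := exists_factor_semilinear hρ q hq (τ.comp g) fun x hx => by
    obtain ⟨y, -, rfl⟩ := hle ((hqk x).1 hx)
    rw [LinearMap.comp_apply, hfg.apply_apply_eq_zero, map_zero]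
  have hmem : ∀ y, q (f y) ∈ LinearMap.ker g' := fun y => by
    rw [LinearMap.mem_ker, hg', LinearMap.comp_apply, hfg.apply_apply_eq_zero, map_zero]
  refine .of_ker g' (fun d => ?_) (ih _ ((q.comp f).codRestrict (LinearMap.ker g') hmem) ?_ ?_)
  · obtain ⟨v, rfl⟩ := hτ.2 d
    obtain ⟨x, rfl⟩ := hg v
    exact ⟨q x, hg' x⟩
  · rintro ⟨m, hm⟩
    obtain ⟨x, rfl⟩ := hq m
    rw [LinearMap.mem_ker, hg', LinearMap.comp_apply] at hm
    obtain ⟨y, rfl⟩ := (hfg x).1 (hτ.1 (by rw [hm, map_zero]))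
    exact ⟨y, rfl⟩
  · intro y
    rw [← Submodule.coe_eq_zero]
    show q (f y) = 0 ↔ _
    rw [hqk]
    refine ⟨fun hy => ?_, fun hy => hle' hy⟩
    obtain ⟨t, ht, hty⟩ := hle hy
    rwa [← hf hty]

variable [IsNoetherianRing A] [IsArtinianRing A]

theorem isFilteredBy_of_hasPStdFilt (hidem : ∀ j, IsPrimitiveIdem A (e j))
    (horth : ∀ i j, i ≠ j → e i * e j = 0)
    (hbasic : ∀ i j, i ≠ j → ¬ Nonempty (↥(leftIdeal A (e i)) ≃ₗ[A] ↥(leftIdeal A (e j))))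
    (hρ : Function.Surjective ρ) {i : Fin n}
    (hρker : ∀ a : A, ρ a = 0 ↔
      a ∈ Submodule.span A {x | ∃ u v : A, x = u * (sumLater A e i) * v})
    (hN : HasPStdFilt A e (fun j => i ≤ j) N)
    {M : Type u} [AddCommGroup M] [Module A' M] (q : N →ₛₗ[ρ] M) (hq : Function.Surjective q)
    (hqk : ∀ x, q x = 0 ↔ x ∈ traceSub (sumLater A e i) N) :
    IsFilteredBy A' (PStd A' (fun j => ρ (e j)) i) M := by
  have hid : ∀ j, IsIdempotentElem (e j) := fun j => (hidem j).1
  have hmem := leftIdealMap_mem_properU_iff hidem horth hbasic hρ hρker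
  let τ : PStd A e i →ₛₗ[ρ] PStd A' (fun j => ρ (e j)) i :=
    Submodule.mapQ _ _ (leftIdealMap ρ (e i)) fun z hz => (hmem z).2 hz
  have hτ : Function.Bijective τ := by
    constructor
    · refine (injective_iff_map_eq_zero τ).2 fun x hx => ?_
      obtain ⟨z, rfl⟩ := Submodule.Quotient.mk_surjective _ x
      rw [Submodule.mapQ_apply, Submodule.Quotient.mk_eq_zero] at hx
      rw [Submodule.Quotient.mk_eq_zero]
      exact (hmem z).1 hx
    · intro y
      obtain ⟨z, rfl⟩ := Submodule.Quotient.mk_surjective _ y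
      obtain ⟨z, rfl⟩ := leftIdealMap_surjective hρ _ z
      exact ⟨Submodule.Quotient.mk z, rfl⟩
  have hV : ∀ v : PStd A e i, sumLater A e i • v = 0 := fun v => by
    obtain ⟨z, rfl⟩ := Submodule.Quotient.mk_surjective _ v
    rw [← Submodule.Quotient.mk_smul, Submodule.Quotient.mk_eq_zero]
    exact traceSub_le_properU hidem hbasic i (smul_mem_traceSub z)
  obtain ⟨m, X, hX0, hXm, hXle, hX⟩ := hN
  have key : ∀ s t, s + t = m → ∀ (M : Type u) [AddCommGroup M] [Module A' M]
      (q : X t →ₛₗ[ρ] M), Function.Surjective q →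
      (∀ x, q x = 0 ↔ x ∈ traceSub (sumLater A e i) (X t)) →
      IsFilteredBy A' (PStd A' (fun j => ρ (e j)) i) M := by
    intro s
    induction s with
    | zero =>
      intro t ht M _ _ q hq _
      obtain rfl : t = m := by omega
      have : Subsingleton (X t) := by rw [hXm]; infer_instance
      have : Subsingleton M := hq.subsingleton
      exact .of_subsingleton M
    | succ s ih =>
      intro t ht M _ _ q hq hqk
      obtain ⟨j, hij, ⟨θ⟩⟩ := hX t (by omega)
      have hf := Submodule.inclusion_injective (hXle t)
      have hg : Function.Surjective (θ.toLinearMap ∘ₗ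
          (Submodule.comap (X t).subtype (X (t + 1))).mkQ) :=
        θ.surjective.comp (Submodule.mkQ_surjective _)
      have hfg : Function.Exact (Submodule.inclusion (hXle t)) (θ.toLinearMap ∘ₗ
          (Submodule.comap (X t).subtype (X (t + 1))).mkQ) := fun x => by
        rw [LinearMap.comp_apply, LinearEquiv.coe_coe, θ.map_eq_zero_iff, Submodule.mkQ_apply,
          Submodule.Quotient.mk_eq_zero]
        exact ⟨fun hx => ⟨⟨x, hx⟩, rfl⟩, by rintro ⟨y, rfl⟩; exact y.2⟩
      rcases hij.lt_or_eq with hlt | rfl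
      · exact isFilteredBy_of_exact_later hid horth hlt _ hf _ hg hfg
          (ih (t + 1) (by omega)) q hq hqk
      · exact isFilteredBy_of_exact_self hρ (sumLater_mul_self horth hid i) hV τ hτ _ hf _ hg hfg
          (ih (t + 1) (by omega)) q hq hqk
  have hsub : ∀ x, x ∈ X 0 := fun x => hX0 ▸ Submodule.mem_top
  refine key m 0 (by omega) M (q.comp (X 0).subtype) ?_ fun x => ?_
  · intro y
    obtain ⟨x, rfl⟩ := hq y
    exact ⟨⟨x, hsub x⟩, rfl⟩
  · rw [LinearMap.comp_apply, hqk]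
    constructor
    · intro hx
      have hle : traceSub (sumLater A e i) N ≤
          Submodule.map (X 0).subtype (traceSub (sumLater A e i) (X 0)) := traceSub_le fun y =>
        ⟨sumLater A e i • ⟨y, hsub y⟩, smul_mem_traceSub _, rfl⟩
      obtain ⟨y, hy, hyx⟩ := hle hx
      rwa [← Subtype.ext hyx]
    · intro hx
      have hle : traceSub (sumLater A e i) (X 0) ≤
          Submodule.comap (X 0).subtype (traceSub (sumLater A e i) N) := traceSub_le fun y =>
        smul_mem_traceSub (y : N)
      exact hle hx

end Filtration

end TraceQuotient

theorem stmt10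
    {K : Type u} [Field K] [IsAlgClosed K]
    {A : Type u} [Ring A] [Algebra K A] [FiniteDimensional K A]
    (n : ℕ) (e : Fin n → A)
    (hidem : ∀ i, IsPrimitiveIdem A (e i))
    (horth : ∀ i j, i ≠ j → e i * e j = 0)
    (hcomplete : ∑ i, e i = 1)
    -- `A` is basic
    (hbasic : ∀ i j, i ≠ j → ¬ Nonempty (↥(leftIdeal A (e i)) ≃ₗ[A] ↥(leftIdeal A (e j))))
    -- `A` is `Δ̄`-filtered
    (hfilt : ∀ i, HasPStdFilt A e (fun j => i ≤ j) ↥(leftIdeal A (e i)))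
    (i : Fin n)
    -- `A' = A/AεA`, `ε = e_{i+1} + ⋯ + e_n`: a `K`-algebra with a surjective ring
    -- homomorphism `ρ : A → A'`, compatible with the algebra structures, whose kernel is
    -- the two-sided ideal `AεA`
    (A' : Type u) [Ring A'] [Algebra K A'] (ρ : A →+* A')
    (hρsurj : Function.Surjective ρ)
    (hρalg : ∀ c : K, ρ (algebraMap K A c) = algebraMap K A' c)
    (hρker : ∀ a : A, ρ a = 0 ↔
      a ∈ Submodule.span A {x | ∃ u v : A, x = u * (sumLater A e i) * v})
    -- a projective resolution `P•` of the properly standard `A'`-module `Δ̄(i)` over `A'`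
    (P : ℕ → Type u) [∀ l, AddCommGroup (P l)] [∀ l, Module A' (P l)]
    [∀ l, Module K (P l)] [∀ l, IsScalarTower K A' (P l)] [∀ l, SMulCommClass A' K (P l)]
    (hproj : ∀ l, Module.Projective A' (P l))
    (dP : ∀ l, P (l + 1) →ₗ[A'] P l)
    (π : P 0 →ₗ[A'] PStd A' (fun j => ρ (e j)) i)
    (hπ : Function.Surjective π)
    (hex0 : Function.Exact (dP 0) π)
    (hex : ∀ l, Function.Exact (dP (l + 1)) (dP l))
    -- a projective resolution `P'•` of `S_E = Hom_{A'}(Δ(i), Δ̄(i))` over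
    -- `E = End_{A'}(Δ(i))ᵒᵖ`, where `Δ(i) = A'ē_i`
    (P' : ℕ → Type u) [∀ l, AddCommGroup (P' l)]
    [∀ l, Module (Module.End A' ↥(leftIdeal A' (ρ (e i))))ᵐᵒᵖ (P' l)]
    [∀ l, Module K (P' l)]
    [∀ l, IsScalarTower K (Module.End A' ↥(leftIdeal A' (ρ (e i))))ᵐᵒᵖ (P' l)]
    [∀ l, SMulCommClass (Module.End A' ↥(leftIdeal A' (ρ (e i))))ᵐᵒᵖ K (P' l)]
    (hproj' : ∀ l, Module.Projective (Module.End A' ↥(leftIdeal A' (ρ (e i))))ᵐᵒᵖ (P' l))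
    (dP' : ∀ l, P' (l + 1) →ₗ[(Module.End A' ↥(leftIdeal A' (ρ (e i))))ᵐᵒᵖ] P' l)
    (π' : P' 0 →ₗ[(Module.End A' ↥(leftIdeal A' (ρ (e i))))ᵐᵒᵖ]
      (↥(leftIdeal A' (ρ (e i))) →ₗ[A'] PStd A' (fun j => ρ (e j)) i))
    (hπ' : Function.Surjective π')
    (hex0' : Function.Exact (dP' 0) π')
    (hex' : ∀ l, Function.Exact (dP' (l + 1)) (dP' l)) :
    -- conclusion: `Ext^*_{A'}(Δ̄(i),Δ̄(i)) ≅ Ext^*_E(S_E,S_E)` as ℤ-graded `K`-algebras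
    ∃ φ : ∀ k, extQ P dP K k ≃ₗ[K] extQ P' dP' K k,
      IsGradedExtAlgIso P dP P' dP' K φ := by
  have hid : ∀ j, IsIdempotentElem (e j) := fun j => (hidem j).1
  have : IsNoetherianRing A := isNoetherian_of_tower K inferInstance
  have : IsArtinianRing A := isArtinian_of_tower K inferInstance
  have : IsNoetherianRing A' := isNoetherianRing_of_surjective A A' ρ hρsurj
  have : Module.Projective A' (leftIdeal A' (ρ (e i))) := projective_leftIdeal ((hid i).map ρ)
  have hΔ : IsFilteredBy A' (PStd A' (fun j => ρ (e j)) i) (leftIdeal A' (ρ (e i))) :=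
    isFilteredBy_of_hasPStdFilt hidem horth hbasic hρsurj hρker (hfilt i)
      (leftIdealMap ρ (e i)) (leftIdealMap_surjective hρsurj _)
      (leftIdealMap_eq_zero_iff hid hρker)
  have hU := hΔ.of_le_ker (properU A' (fun j => ρ (e j)) i)
    (properU_le_ker fun j => (hid j).map ρ)
  have hD : IsFilteredBy A' (PStd A' (fun j => ρ (e j)) i) (PStd A' (fun j => ρ (e j)) i) :=
    .of_ker LinearMap.id Function.surjective_id
      (by
        have := (LinearMap.ker_eq_bot (f := (LinearMap.id : PStd A' (fun j => ρ (e j)) i →ₗ[A'] _))).2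
          Function.injective_id
        have : Subsingleton (LinearMap.ker
            (LinearMap.id : PStd A' (fun j => ρ (e j)) i →ₗ[A'] _)) := by
          rw [this]
          infer_instance
        exact .of_subsingleton _)
  obtain ⟨Q, dQ, πQ, hQ, hπQ, hQ0, hQ1⟩ := IsFilteredBy.exists_add_resolution
    (properU A' (fun j => ρ (e j)) i).mkQ (Submodule.mkQ_surjective _)
    (hU.congr (LinearEquiv.ofEq _ _ (Submodule.ker_mkQ _))) hD
  exact exists_gradedExtAlgIso_of_add_resolution hproj dP π hπ hex0 hex hproj' dP' π' hπ' hex0'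
    hex' hQ dQ πQ hπQ hQ0 hQ1

end
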